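/- There exist a real number r > 1 and a constant c ≥ 1 such that c⁻¹·rⁿ ≤ 𝓡_n ≤ c·rⁿ for all n ≥ 0. (Exact geometric growth of the resistance sequence; equation (3.16) of the paper in the planar case.) -/

import Mathlib

open Finset
open scoped Classical

namespace Carpet

/-- The contraction map `Ψ_{(a,b)}(x,y) = ((x+a)/L, (y+b)/L)`. -/
noncomputable def Psi (L : ℕ) (p : ℕ × ℕ) (x : ℝ × ℝ) : ℝ × ℝ :=
  ((x.1 + p.1) / L, (x.2 + p.2) / L)

/-- Words of length `n` over the alphabet `A`. -/
abbrev Word (A : Finset (ℕ × ℕ)) (n : ℕ) := Fin n → {p : ℕ × ℕ // p ∈ A}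

/-- `Ψ_w = Ψ_{w₁} ∘ ⋯ ∘ Ψ_{w_n}`. -/
noncomputable def PsiW (L : ℕ) {A : Finset (ℕ × ℕ)} {n : ℕ} (w : Word A n) : ℝ × ℝ → ℝ × ℝ :=
  (List.ofFn fun i => Psi L (w i).1).foldr (· ∘ ·) id

/-- The four corners of the unit square. -/
noncomputable def V0 : Finset (ℝ × ℝ) :=
  {((0 : ℝ), (0 : ℝ)), ((1 : ℝ), (0 : ℝ)), ((1 : ℝ), (1 : ℝ)), ((0 : ℝ), (1 : ℝ))}

/-- The level-`n` vertex set `V_n = ⋃_{w ∈ W_n} Ψ_w(V₀)`. -/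
noncomputable def VN (L : ℕ) (A : Finset (ℕ × ℕ)) (n : ℕ) : Finset (ℝ × ℝ) :=
  (Finset.univ : Finset (Word A n)).biUnion fun w => V0.image (PsiW L w)

/-- Euclidean distance in the plane. -/
noncomputable def eudist (x y : ℝ × ℝ) : ℝ :=
  Real.sqrt ((x.1 - y.1) ^ 2 + (x.2 - y.2) ^ 2)

/-- `n`-adjacency: `x = Ψ_w(p)`, `y = Ψ_w(q)` with `p, q ∈ V₀`, `|p - q| = 1`. -/
def Adj (L : ℕ) (A : Finset (ℕ × ℕ)) (n : ℕ) (x y : ℝ × ℝ) : Prop :=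
  ∃ w : Word A n, ∃ p ∈ V0, ∃ q ∈ V0,
    eudist p q = 1 ∧ x = PsiW L w p ∧ y = PsiW L w q

/-- The natural graph energy `D_n(f) = Σ_{x ∼ y} (f x - f y)²`
(summing over ordered pairs and halving). -/
noncomputable def Dform (L : ℕ) (A : Finset (ℕ × ℕ)) (n : ℕ) (f : ℝ × ℝ → ℝ) : ℝ :=
  (1 / 2) * ∑ x ∈ VN L A n, ∑ y ∈ VN L A n,
    (if Adj L A n x y then (f x - f y) ^ 2 else 0)

/-- The effective resistance between `S` and `T` in the level-`n` graph. -/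
noncomputable def EffRes (L : ℕ) (A : Finset (ℕ × ℕ)) (n : ℕ) (S T : Set (ℝ × ℝ)) : ℝ :=
  (sInf {e : ℝ | ∃ f : ℝ × ℝ → ℝ,
      (∀ x ∈ S, f x = 1) ∧ (∀ x ∈ T, f x = 0) ∧ e = Dform L A n f})⁻¹

/-- `𝓡_n`, the resistance between the corners `(0,0)` and `(1,0)`. -/
noncomputable def RR (L : ℕ) (A : Finset (ℕ × ℕ)) (n : ℕ) : ℝ :=
  EffRes L A n {((0 : ℝ), (0 : ℝ))} {((1 : ℝ), (0 : ℝ))}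

/-- `𝓡̄_n`, the resistance between the left and right sides of the unit square. -/
noncomputable def RRbar (L : ℕ) (A : Finset (ℕ × ℕ)) (n : ℕ) : ℝ :=
  EffRes L A n
    ((VN L A n : Set (ℝ × ℝ)) ∩ ({(0 : ℝ)} ×ˢ Set.Icc (0 : ℝ) 1))
    ((VN L A n : Set (ℝ × ℝ)) ∩ ({(1 : ℝ)} ×ˢ Set.Icc (0 : ℝ) 1))

/-- The standing assumptions on `(L, A)` defining a generalized Sierpiński carpet. -/
structure GoodCarpet (L : ℕ) (A : Finset (ℕ × ℕ)) : Prop where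
  three_le : 3 ≤ L
  mem_lt : ∀ p ∈ A, p.1 < L ∧ p.2 < L
  symm_swap : ∀ a b : ℕ, (a, b) ∈ A → (b, a) ∈ A
  symm_reflect : ∀ a b : ℕ, (a, b) ∈ A → (L - 1 - a, b) ∈ A
  connected : IsConnected
    (⋃ p ∈ A, Set.Icc (((p.1 : ℝ) / L, (p.2 : ℝ) / L) : ℝ × ℝ)
      ((((p.1 : ℝ) + 1) / L, ((p.2 : ℝ) + 1) / L) : ℝ × ℝ))
  flat_border : ∀ a b : ℕ, a < L → b < L →
    (a = 0 ∨ a = L - 1 ∨ b = 0 ∨ b = L - 1) → (a, b) ∈ A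
  proper : ∃ a b : ℕ, a < L ∧ b < L ∧ (a, b) ∉ A

/-- The generalized Sierpiński carpet `F`. -/
def carpetF (L : ℕ) (A : Finset (ℕ × ℕ)) : Set (ℝ × ℝ) :=
  ⋂ n : ℕ, ⋃ w : Word A n, PsiW L w '' Set.Icc (((0 : ℝ), (0 : ℝ)) : ℝ × ℝ) ((1 : ℝ), (1 : ℝ))


/-! ### Integer cells and the cell energy -/

/-- The level-`n` cells, as integer positions in `[0, L^n)²`. -/
noncomputable def cells (L : ℕ) (A : Finset (ℕ × ℕ)) : ℕ → Finset (ℕ × ℕ)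
  | 0 => {(0, 0)}
  | n + 1 => (A ×ˢ cells L A n).image
      (fun x => (L ^ n * x.1.1 + x.2.1, L ^ n * x.1.2 + x.2.2))

/-- Energy of one unit cell. -/
def ce (f : ℕ → ℕ → ℝ) (i j : ℕ) : ℝ :=
  (f i j - f (i + 1) j) ^ 2 + (f i (j + 1) - f (i + 1) (j + 1)) ^ 2 +
  (f i j - f i (j + 1)) ^ 2 + (f (i + 1) j - f (i + 1) (j + 1)) ^ 2

/-- Level-`n` cell energy. -/
noncomputable def en (L : ℕ) (A : Finset (ℕ × ℕ)) (n : ℕ) (f : ℕ → ℕ → ℝ) : ℝ :=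
  ∑ c ∈ cells L A n, ce f c.1 c.2

lemma ce_nonneg (f : ℕ → ℕ → ℝ) (i j : ℕ) : 0 ≤ ce f i j := by unfold ce; positivity

lemma en_nonneg (L : ℕ) (A : Finset (ℕ × ℕ)) (n : ℕ) (f : ℕ → ℕ → ℝ) : 0 ≤ en L A n f :=
  sum_nonneg fun _ _ => ce_nonneg _ _ _

section
variable {L : ℕ} {A : Finset (ℕ × ℕ)}

lemma lpos (h : GoodCarpet L A) : 0 < L := by have := h.three_le; omega

lemma npos (h : GoodCarpet L A) (n : ℕ) : 0 < L ^ n := pow_pos (lpos h) n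

lemma cells_lt (h : GoodCarpet L A) (n : ℕ) :
    ∀ c ∈ cells L A n, c.1 < L ^ n ∧ c.2 < L ^ n := by
  induction n with
  | zero => intro c hc; simp [cells] at hc; simp [hc]
  | succ n ih =>
    intro c hc
    simp only [cells, mem_image, mem_product] at hc
    obtain ⟨⟨a, d⟩, ⟨ha, hd⟩, rfl⟩ := hc
    have h1 := h.mem_lt a ha
    have h2 := ih d hd
    have e1 : L ^ n * (a.1 + 1) ≤ L ^ n * L := Nat.mul_le_mul_left _ h1.1
    have e2 : L ^ n * (a.2 + 1) ≤ L ^ n * L := Nat.mul_le_mul_left _ h1.2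
    simp only [pow_succ]
    constructor <;> nlinarith

lemma dm_inj {N a b c d : ℕ} (hb : b < N) (hd : d < N) (e : N * a + b = N * c + d) :
    a = c ∧ b = d := by
  have h1 : (N * a + b) / N = (N * c + d) / N := by rw [e]
  have h2 : (N * a + b) % N = (N * c + d) % N := by rw [e]
  have hN : 0 < N := by omega
  rw [Nat.mul_add_div hN, Nat.mul_add_div hN, Nat.div_eq_of_lt hb, Nat.div_eq_of_lt hd] at h1
  rw [Nat.mul_add_mod, Nat.mul_add_mod, Nat.mod_eq_of_lt hb, Nat.mod_eq_of_lt hd] at h2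
  exact ⟨h1, h2⟩

lemma sum_succ (h : GoodCarpet L A) (n : ℕ) (g : ℕ × ℕ → ℝ) :
    ∑ c ∈ cells L A (n + 1), g c =
      ∑ a ∈ A, ∑ d ∈ cells L A n, g (L ^ n * a.1 + d.1, L ^ n * a.2 + d.2) := by
  rw [cells, sum_image, sum_product]
  rintro ⟨a, d⟩ hx ⟨a', d'⟩ hx' e
  simp only [coe_product, Set.mem_prod, mem_coe] at hx hx'
  simp only [Prod.mk.injEq] at e
  have h1 := cells_lt h n d hx.2
  have h2 := cells_lt h n d' hx'.2
  have e1 := dm_inj h1.1 h2.1 e.1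
  have e2 := dm_inj h1.2 h2.2 e.2
  exact Prod.ext (Prod.ext e1.1 e2.1) (Prod.ext e1.2 e2.2)

lemma sum_add (h : GoodCarpet L A) (n m : ℕ) (g : ℕ × ℕ → ℝ) :
    ∑ c ∈ cells L A (n + m), g c =
      ∑ c ∈ cells L A n, ∑ d ∈ cells L A m, g (L ^ m * c.1 + d.1, L ^ m * c.2 + d.2) := by
  induction n generalizing g with
  | zero => simp [cells]
  | succ n ih =>
    rw [show n + 1 + m = (n + m) + 1 by ring, sum_succ h, sum_succ h]
    refine sum_congr rfl fun a _ => ?_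
    rw [ih]
    refine sum_congr rfl fun c _ => sum_congr rfl fun d _ => ?_
    congr 2 <;> ring

lemma en_add (h : GoodCarpet L A) (n m : ℕ) (f : ℕ → ℕ → ℝ) :
    en L A (n + m) f =
      ∑ c ∈ cells L A n, en L A m (fun x y => f (L ^ m * c.1 + x) (L ^ m * c.2 + y)) := by
  unfold en
  rw [sum_add h]
  rfl

lemma cells_swap (h : GoodCarpet L A) (n : ℕ) :
    ∀ c ∈ cells L A n, (c.2, c.1) ∈ cells L A n := by
  induction n with
  | zero => intro c hc; simp [cells] at hc ⊢; simp [hc]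
  | succ n ih =>
    intro c hc
    simp only [cells, mem_image, mem_product] at hc ⊢
    obtain ⟨⟨a, d⟩, ⟨ha, hd⟩, rfl⟩ := hc
    exact ⟨⟨(a.2, a.1), (d.2, d.1)⟩, ⟨h.symm_swap _ _ ha, ih _ hd⟩, rfl⟩

lemma refl_aux {N L a d : ℕ} (ha : a < L) (hd : d < N) :
    N * (L - 1 - a) + (N - 1 - d) = N * L - 1 - (N * a + d) := by
  obtain ⟨k, rfl⟩ := Nat.exists_eq_add_of_lt ha
  obtain ⟨l, rfl⟩ := Nat.exists_eq_add_of_lt hd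
  have e1 : a + k + 1 - 1 - a = k := by omega
  have e2 : d + l + 1 - 1 - d = l := by omega
  rw [e1, e2]
  have : (d + l + 1) * (a + k + 1) = (d + l + 1) * a + (d + l + 1) * k + (d + l + 1) := by ring
  omega

lemma cells_refl (h : GoodCarpet L A) (n : ℕ) :
    ∀ c ∈ cells L A n, (L ^ n - 1 - c.1, c.2) ∈ cells L A n := by
  induction n with
  | zero => intro c hc; simp [cells] at hc ⊢; simp [hc]
  | succ n ih =>
    intro c hc
    have hc' := hc
    simp only [cells, mem_image, mem_product] at hc ⊢
    obtain ⟨⟨a, d⟩, ⟨ha, hd⟩, rfl⟩ := hc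
    refine ⟨⟨(L - 1 - a.1, a.2), (L ^ n - 1 - d.1, d.2)⟩, ⟨h.symm_reflect _ _ ha, ih _ hd⟩, ?_⟩
    have := refl_aux (h.mem_lt a ha).1 (cells_lt h n d hd).1
    simp only [pow_succ, this]

lemma en_swap (h : GoodCarpet L A) (n : ℕ) (f : ℕ → ℕ → ℝ) :
    en L A n (fun x y => f y x) = en L A n f := by
  unfold en
  refine sum_nbij' (fun c => (c.2, c.1)) (fun c => (c.2, c.1)) (cells_swap h n) (cells_swap h n)
    (fun _ _ => rfl) (fun _ _ => rfl) ?_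
  intro c _
  simp only [ce]
  ring

lemma en_refl (h : GoodCarpet L A) (n : ℕ) (f : ℕ → ℕ → ℝ) :
    en L A n (fun x y => f (L ^ n - x) y) = en L A n f := by
  unfold en
  refine sum_nbij' (fun c => (L ^ n - 1 - c.1, c.2)) (fun c => (L ^ n - 1 - c.1, c.2))
    (cells_refl h n) (cells_refl h n) ?_ ?_ ?_
  · intro c hc
    have := cells_lt h n c hc
    ext <;> simp; omega
  · intro c hc
    have := cells_lt h n c hc
    ext <;> simp; omega
  · intro c hc
    have := cells_lt h n c hc
    have e1 : L ^ n - c.1 = L ^ n - 1 - c.1 + 1 := by omega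
    have e2 : L ^ n - (c.1 + 1) = L ^ n - 1 - c.1 := by omega
    simp only [ce, e1, e2]
    ring

lemma en_refl_y (h : GoodCarpet L A) (n : ℕ) (f : ℕ → ℕ → ℝ) :
    en L A n (fun x y => f x (L ^ n - y)) = en L A n f := by
  rw [← en_swap h n (fun x y => f x (L ^ n - y)), ← en_swap h n f]
  exact en_refl h n (fun x y => f y x)

/-- Corner to corner conductance. -/
noncomputable def EE (L : ℕ) (A : Finset (ℕ × ℕ)) (n : ℕ) : ℝ :=
  sInf {e : ℝ | ∃ f : ℕ → ℕ → ℝ, f 0 0 = 1 ∧ f (L ^ n) 0 = 0 ∧ e = en L A n f}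

/-- Side to side conductance. -/
noncomputable def EB (L : ℕ) (A : Finset (ℕ × ℕ)) (n : ℕ) : ℝ :=
  sInf {e : ℝ | ∃ f : ℕ → ℕ → ℝ, (∀ y ≤ L ^ n, f 0 y = 1) ∧ (∀ y ≤ L ^ n, f (L ^ n) y = 0) ∧
    e = en L A n f}

lemma EE_bdd (n : ℕ) : BddBelow {e : ℝ | ∃ f : ℕ → ℕ → ℝ, f 0 0 = 1 ∧ f (L ^ n) 0 = 0 ∧
    e = en L A n f} := ⟨0, by rintro e ⟨f, _, _, rfl⟩; exact en_nonneg _ _ _ _⟩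

lemma EB_bdd (n : ℕ) : BddBelow {e : ℝ | ∃ f : ℕ → ℕ → ℝ, (∀ y ≤ L ^ n, f 0 y = 1) ∧
    (∀ y ≤ L ^ n, f (L ^ n) y = 0) ∧ e = en L A n f} :=
  ⟨0, by rintro e ⟨f, _, _, rfl⟩; exact en_nonneg _ _ _ _⟩

lemma EB_ne (h : GoodCarpet L A) (n : ℕ) : {e : ℝ | ∃ f : ℕ → ℕ → ℝ, (∀ y ≤ L ^ n, f 0 y = 1) ∧
    (∀ y ≤ L ^ n, f (L ^ n) y = 0) ∧ e = en L A n f}.Nonempty := by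
  refine ⟨_, fun x _ => if x = 0 then 1 else 0, by simp, ?_, rfl⟩
  have := npos h n
  intro y _
  simp [(lpos h).ne']

lemma EE_ne (h : GoodCarpet L A) (n : ℕ) : {e : ℝ | ∃ f : ℕ → ℕ → ℝ, f 0 0 = 1 ∧
    f (L ^ n) 0 = 0 ∧ e = en L A n f}.Nonempty := by
  obtain ⟨e, f, h1, h2, h3⟩ := EB_ne h n
  exact ⟨e, f, h1 0 (Nat.zero_le _), h2 0 (Nat.zero_le _), h3⟩

lemma EE_le (n : ℕ) (f : ℕ → ℕ → ℝ) (h0 : f 0 0 = 1) (h1 : f (L ^ n) 0 = 0) :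
    EE L A n ≤ en L A n f := csInf_le (EE_bdd n) ⟨f, h0, h1, rfl⟩

lemma EB_le (n : ℕ) (f : ℕ → ℕ → ℝ) (h0 : ∀ y ≤ L ^ n, f 0 y = 1)
    (h1 : ∀ y ≤ L ^ n, f (L ^ n) y = 0) :
    EB L A n ≤ en L A n f := csInf_le (EB_bdd n) ⟨f, h0, h1, rfl⟩

lemma EE_nonneg (h : GoodCarpet L A) (n : ℕ) : 0 ≤ EE L A n :=
  le_csInf (EE_ne h n) (by rintro e ⟨f, _, _, rfl⟩; exact en_nonneg _ _ _ _)

lemma EE_le_EB (h : GoodCarpet L A) (n : ℕ) : EE L A n ≤ EB L A n := by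
  refine le_csInf (EB_ne h n) ?_
  rintro e ⟨f, h1, h2, rfl⟩
  exact EE_le n f (h1 0 (Nat.zero_le _)) (h2 0 (Nat.zero_le _))

/-! ### Submultiplicativity of the resistance -/

lemma en_affine (n : ℕ) (f : ℕ → ℕ → ℝ) (a b : ℝ) :
    en L A n (fun x y => a * f x y + b) = a ^ 2 * en L A n f := by
  unfold en
  rw [mul_sum]
  refine sum_congr rfl fun c _ => ?_
  simp only [ce]; ring

lemma EE_scale (n : ℕ) (f : ℕ → ℕ → ℝ) :
    (f 0 0 - f (L ^ n) 0) ^ 2 * EE L A n ≤ en L A n f := by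
  by_cases ht : f 0 0 - f (L ^ n) 0 = 0
  · rw [ht]; simpa using en_nonneg _ _ _ _
  · set t := f 0 0 - f (L ^ n) 0 with hdt
    have := EE_le (L := L) (A := A) n (fun x y => t⁻¹ * f x y + (- (t⁻¹ * f (L ^ n) 0)))
      (by rw [← sub_eq_add_neg, ← mul_sub, ← hdt, inv_mul_cancel₀ ht]) (by ring)
    rw [en_affine] at this
    calc t ^ 2 * EE L A n ≤ t ^ 2 * (t⁻¹ ^ 2 * en L A n f) := by gcongr
      _ = en L A n f := by field_simp

lemma EE_sides (h : GoodCarpet L A) (n : ℕ) (f : ℕ → ℕ → ℝ) :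
    ((f 0 0 - f (L ^ n) 0) ^ 2 + (f 0 (L ^ n) - f (L ^ n) (L ^ n)) ^ 2 +
      (f 0 0 - f 0 (L ^ n)) ^ 2 + (f (L ^ n) 0 - f (L ^ n) (L ^ n)) ^ 2) * EE L A n
      ≤ 4 * en L A n f := by
  have h1 := EE_scale (L := L) (A := A) n f
  have h2 := EE_scale (L := L) (A := A) n (fun x y => f x (L ^ n - y))
  have h3 := EE_scale (L := L) (A := A) n (fun x y => f y x)
  have h4 := EE_scale (L := L) (A := A) n (fun x y => f (L ^ n - y) x)
  rw [en_refl_y h] at h2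
  rw [en_swap h] at h3
  rw [en_swap h n (fun x y => f (L ^ n - x) y), en_refl h] at h4
  simp only [Nat.sub_zero] at h2 h4
  linarith

lemma EE_sub (h : GoodCarpet L A) (n m : ℕ) : EE L A n * EE L A m ≤ 4 * EE L A (n + m) := by
  have hm := EE_nonneg h m
  suffices EE L A n * EE L A m / 4 ≤ EE L A (n + m) by linarith
  refine le_csInf (EE_ne h _) ?_
  rintro e ⟨f, h0, h1, rfl⟩
  have key : en L A n (fun i j => f (L ^ m * i) (L ^ m * j)) * EE L A m ≤
      4 * en L A (n + m) f := by
    rw [en_add h, en, sum_mul, mul_sum]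
    refine sum_le_sum fun c _ => ?_
    have := EE_sides h m (fun x y => f (L ^ m * c.1 + x) (L ^ m * c.2 + y))
    simpa only [ce, mul_add, mul_one, add_zero] using this
  have := EE_le (A := A) n (fun i j => f (L ^ m * i) (L ^ m * j)) (by simpa using h0)
    (by rw [← h1, ← pow_add, add_comm m n]; simp)
  have := mul_le_mul_of_nonneg_right this hm
  linarith

lemma EE_zero : 1 ≤ EE L A 0 := by
  refine le_csInf ?_ ?_
  · exact ⟨_, fun x y => 1 - x, by simp, by simp, rfl⟩
  · rintro e ⟨f, h0, h1, rfl⟩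
    simp only [pow_zero] at h1
    simp only [en, cells, sum_singleton, ce, zero_add, h0, h1]
    nlinarith [sq_nonneg (f 0 1 - f 1 1), sq_nonneg (1 - f 0 1), sq_nonneg (0 - f 1 1)]

lemma sum_bottom (h : GoodCarpet L A) (g : ℕ × ℕ → ℝ) (hg : ∀ a, 0 ≤ g a) :
    ∑ i ∈ range L, g (i, 0) ≤ ∑ a ∈ A, g a := by
  rw [← sum_image (s := range L) (g := fun i => (i, 0)) (f := g) (by intro a _ b _ e; simpa using e)]
  refine sum_le_sum_of_subset_of_nonneg ?_ (fun _ _ _ => hg _)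
  intro a ha
  simp only [mem_image, mem_range] at ha
  obtain ⟨i, hi, rfl⟩ := ha
  exact h.flat_border _ _ hi (lpos h) (by simp)

lemma EE_one (h : GoodCarpet L A) : 0 < EE L A 1 := by
  have hL := lpos h
  have hL' : (0 : ℝ) < L := by exact_mod_cast hL
  refine lt_of_lt_of_le (inv_pos.2 hL') (le_csInf (EE_ne h _) ?_)
  rintro e ⟨f, h0, h1, rfl⟩
  have h2 : ∑ i ∈ range L, (f i 0 - f (i + 1) 0) = 1 := by
    rw [sum_range_sub' (fun i => f i 0)]; simp only [pow_one] at h1; rw [h0, h1]; ring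
  have h3 := sq_sum_le_card_mul_sum_sq (s := range L) (f := fun i => f i 0 - f (i + 1) 0)
  rw [h2, card_range] at h3
  have h4 := sum_bottom h (fun a => ce f a.1 a.2) (fun _ => ce_nonneg _ _ _)
  have h5 : en L A 1 f = ∑ a ∈ A, ce f a.1 a.2 := by
    rw [en, show (1 : ℕ) = 0 + 1 from rfl, sum_succ h]; simp [cells]
  have h6 : ∑ i ∈ range L, (f i 0 - f (i + 1) 0) ^ 2 ≤ en L A 1 f := by
    rw [h5]
    refine le_trans (sum_le_sum fun i _ => ?_) h4
    simp only [ce]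
    nlinarith [sq_nonneg (f i (0+1) - f (i+1) (0+1)), sq_nonneg (f i 0 - f i (0+1)),
      sq_nonneg (f (i+1) 0 - f (i+1) (0+1))]
  rw [inv_le_iff_one_le_mul₀ hL']
  nlinarith

lemma EE_pos (h : GoodCarpet L A) (n : ℕ) : 0 < EE L A n := by
  induction n with
  | zero => linarith [EE_zero (L := L) (A := A)]
  | succ n ih =>
    have := EE_sub h n 1
    have := mul_pos ih (EE_one h)
    linarith

lemma EB_pos (h : GoodCarpet L A) (n : ℕ) : 0 < EB L A n :=
  lt_of_lt_of_le (EE_pos h n) (EE_le_EB h n)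
end

/-! ### Interpolation: supermultiplicativity of the resistance -/

section
variable {L : ℕ} {A : Finset (ℕ × ℕ)}

lemma en_mono (n : ℕ) (f g : ℕ → ℕ → ℝ)
    (hfg : ∀ x y x' y', |f x y - f x' y'| ≤ |g x y - g x' y'|) : en L A n f ≤ en L A n g := by
  refine sum_le_sum fun c _ => ?_
  have hs : ∀ x y x' y', (f x y - f x' y') ^ 2 ≤ (g x y - g x' y') ^ 2 :=
    fun x y x' y' => sq_le_sq.2 (hfg x y x' y')
  unfold ce
  linarith [hs c.1 c.2 (c.1 + 1) c.2, hs c.1 (c.2 + 1) (c.1 + 1) (c.2 + 1),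
    hs c.1 c.2 c.1 (c.2 + 1), hs (c.1 + 1) c.2 (c.1 + 1) (c.2 + 1)]

lemma exists_nice (h : GoodCarpet L A) (n : ℕ) : ∃ u : ℕ → ℕ → ℝ,
    (∀ x y, 0 ≤ u x y ∧ u x y ≤ 1) ∧ (∀ x, u x 0 = u x (L ^ n)) ∧ (∀ y ≤ L ^ n, u 0 y = 1) ∧
    (∀ y ≤ L ^ n, u (L ^ n) y = 0) ∧ en L A n u ≤ 2 * EB L A n := by
  have hp := EB_pos h n
  obtain ⟨e, ⟨u, h1, h2, rfl⟩, h3⟩ := exists_lt_of_csInf_lt (EB_ne h n)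
    (show EB L A n < 2 * EB L A n by linarith)
  set v : ℕ → ℕ → ℝ := fun x y => max 0 (min 1 (u x y)) with hv
  have hv1 : en L A n v ≤ en L A n u := by
    refine en_mono n _ _ fun x y x' y' => ?_
    simp only [hv]
    have h1 := abs_max_sub_max_le_max 0 (min 1 (u x y)) 0 (min 1 (u x' y'))
    have h2 := abs_min_sub_min_le_max 1 (u x y) 1 (u x' y')
    simp only [sub_self, abs_zero] at h1 h2
    exact h1.trans (max_le (abs_nonneg _) (h2.trans (max_le (abs_nonneg _) le_rfl)))
  have hv2 : ∀ x y, 0 ≤ v x y ∧ v x y ≤ 1 := fun x y => by simp [hv]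
  have hv3 : ∀ y ≤ L ^ n, v 0 y = 1 := fun y hy => by simp [hv, h1 y hy]
  have hv4 : ∀ y ≤ L ^ n, v (L ^ n) y = 0 := fun y hy => by simp [hv, h2 y hy]
  refine ⟨fun x y => (v x y + v x (L ^ n - y)) / 2, ?_, ?_, ?_, ?_, ?_⟩
  · intro x y
    have := hv2 x y
    have := hv2 x (L ^ n - y)
    constructor <;> linarith
  · intro x
    simp [add_comm]
  · intro y hy
    simp only [hv3 y hy, hv3 (L ^ n - y) (Nat.sub_le _ _)]; norm_num
  · intro y hy
    simp only [hv4 y hy, hv4 (L ^ n - y) (Nat.sub_le _ _)]; norm_num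
  · have : en L A n (fun x y => (v x y + v x (L ^ n - y)) / 2) ≤
        (en L A n v + en L A n (fun x y => v x (L ^ n - y))) / 2 := by
      rw [en, en, en, ← sum_add_distrib, sum_div]
      refine sum_le_sum fun c _ => ?_
      have key : ∀ a b c d : ℝ, ((a + b) / 2 - (c + d) / 2) ^ 2 ≤ ((a - c) ^ 2 + (b - d) ^ 2) / 2 := by
        intro a b c d; nlinarith [sq_nonneg (a - c - (b - d))]
      simp only [ce]
      have k1 := key (v c.1 c.2) (v c.1 (L ^ n - c.2)) (v (c.1 + 1) c.2) (v (c.1 + 1) (L ^ n - c.2))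
      have k2 := key (v c.1 (c.2 + 1)) (v c.1 (L ^ n - (c.2 + 1))) (v (c.1 + 1) (c.2 + 1))
        (v (c.1 + 1) (L ^ n - (c.2 + 1)))
      have k3 := key (v c.1 c.2) (v c.1 (L ^ n - c.2)) (v c.1 (c.2 + 1)) (v c.1 (L ^ n - (c.2 + 1)))
      have k4 := key (v (c.1 + 1) c.2) (v (c.1 + 1) (L ^ n - c.2)) (v (c.1 + 1) (c.2 + 1))
        (v (c.1 + 1) (L ^ n - (c.2 + 1)))
      linarith
    rw [en_refl_y h] at this
    linarith

/-- Bilinear combination of corner values. -/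
def bil (a b c d u v : ℝ) : ℝ :=
  a * (u * v) + b * ((1 - u) * v) + c * (u * (1 - v)) + d * ((1 - u) * (1 - v))

lemma bil_sq (a b c d u v u' v' : ℝ) (hu : 0 ≤ u' ∧ u' ≤ 1) (hv : 0 ≤ v ∧ v ≤ 1) :
    (bil a b c d u v - bil a b c d u' v') ^ 2 ≤
      2 * ((u - u') ^ 2 + (v - v') ^ 2) *
        ((a - b) ^ 2 + (c - d) ^ 2 + (a - c) ^ 2 + (b - d) ^ 2) := by
  have conv : ∀ t x y : ℝ, 0 ≤ t ∧ t ≤ 1 → (t * x + (1 - t) * y) ^ 2 ≤ x ^ 2 + y ^ 2 := by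
    intro t x y ht
    have h1 : (t * x + (1 - t) * y) ^ 2 = t * x ^ 2 + (1 - t) * y ^ 2 - t * (1 - t) * (x - y) ^ 2 := by
      ring
    have h2 : 0 ≤ t * (1 - t) * (x - y) ^ 2 :=
      mul_nonneg (mul_nonneg ht.1 (by linarith [ht.2])) (sq_nonneg _)
    nlinarith [mul_nonneg ht.1 (sq_nonneg y), mul_nonneg (sub_nonneg.2 ht.2) (sq_nonneg x)]
  have e : bil a b c d u v - bil a b c d u' v' =
      (u - u') * (v * (a - b) + (1 - v) * (c - d)) +
      (v - v') * (u' * (a - c) + (1 - u') * (b - d)) := by unfold bil; ring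
  rw [e]
  have c1 := conv v (a - b) (c - d) hv
  have c2 := conv u' (a - c) (b - d) hu
  set X := v * (a - b) + (1 - v) * (c - d)
  set Y := u' * (a - c) + (1 - u') * (b - d)
  clear_value X Y
  clear e conv
  have h1 : ((u - u') * X + (v - v') * Y) ^ 2 ≤ 2 * ((u - u') ^ 2 * X ^ 2) + 2 * ((v - v') ^ 2 * Y ^ 2) := by
    nlinarith [sq_nonneg ((u - u') * X - (v - v') * Y)]
  have h2 : (u - u') ^ 2 * X ^ 2 ≤ (u - u') ^ 2 *
      ((a - b) ^ 2 + (c - d) ^ 2 + (a - c) ^ 2 + (b - d) ^ 2) :=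
    mul_le_mul_of_nonneg_left (by linarith [sq_nonneg (a - c), sq_nonneg (b - d)]) (sq_nonneg _)
  have h3 : (v - v') ^ 2 * Y ^ 2 ≤ (v - v') ^ 2 *
      ((a - b) ^ 2 + (c - d) ^ 2 + (a - c) ^ 2 + (b - d) ^ 2) :=
    mul_le_mul_of_nonneg_left (by linarith [sq_nonneg (a - b), sq_nonneg (c - d)]) (sq_nonneg _)
  linarith

/-- Interpolation of `f` on a grid of mesh `M`, with profile `u`. -/
noncomputable def interp (M : ℕ) (u f : ℕ → ℕ → ℝ) (x y : ℕ) : ℝ :=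
  bil (f (x / M) (y / M)) (f (x / M + 1) (y / M)) (f (x / M) (y / M + 1)) (f (x / M + 1) (y / M + 1))
    (u (x % M) (y % M)) (u (y % M) (x % M))

lemma interp_lt {M : ℕ} (u f : ℕ → ℕ → ℝ) {i j s t : ℕ} (hs : s < M) (ht : t < M) :
    interp M u f (M * i + s) (M * j + t) =
      bil (f i j) (f (i + 1) j) (f i (j + 1)) (f (i + 1) (j + 1)) (u s t) (u t s) := by
  have hM : 0 < M := by omega
  unfold interp
  rw [Nat.mul_add_div hM, Nat.mul_add_div hM, Nat.mul_add_mod, Nat.mul_add_mod,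
    Nat.div_eq_of_lt hs, Nat.div_eq_of_lt ht, Nat.mod_eq_of_lt hs, Nat.mod_eq_of_lt ht]
  rfl

lemma interp_eq {M : ℕ} (hM : 0 < M) (u f : ℕ → ℕ → ℝ) (hsym : ∀ x, u x 0 = u x M)
    (h0 : ∀ y ≤ M, u 0 y = 1) (h1 : ∀ y ≤ M, u M y = 0) {i j s t : ℕ} (hs : s ≤ M) (ht : t ≤ M) :
    interp M u f (M * i + s) (M * j + t) =
      bil (f i j) (f (i + 1) j) (f i (j + 1)) (f (i + 1) (j + 1)) (u s t) (u t s) := by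
  rcases hs.lt_or_eq with hs' | rfl
  · rcases ht.lt_or_eq with ht' | rfl
    · exact interp_lt u f hs' ht'
    · rw [show t * j + t = t * (j + 1) + 0 by ring, interp_lt u f hs' hM, h0 s hs, h1 s hs, hsym s]
      simp only [bil]; ring
  · rcases ht.lt_or_eq with ht' | rfl
    · rw [show s * i + s = s * (i + 1) + 0 by ring, interp_lt u f hM ht', h0 t ht, h1 t ht, hsym t]
      simp only [bil]; ring
    · rw [show t * i + t = t * (i + 1) + 0 by ring, show t * j + t = t * (j + 1) + 0 by ring,
        interp_lt u f hM hM, h0 0 hM.le, h1 t le_rfl]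
      simp only [bil]; ring

lemma interp_energy (h : GoodCarpet L A) (n m : ℕ) (u f : ℕ → ℕ → ℝ)
    (hu : ∀ x y, 0 ≤ u x y ∧ u x y ≤ 1) (hsym : ∀ x, u x 0 = u x (L ^ m))
    (h0 : ∀ y ≤ L ^ m, u 0 y = 1) (h1 : ∀ y ≤ L ^ m, u (L ^ m) y = 0) :
    en L A (n + m) (interp (L ^ m) u f) ≤ 4 * en L A m u * en L A n f := by
  rw [en_add h, en.eq_1 L A n f, mul_sum]
  refine sum_le_sum fun c _ => ?_
  have key : en L A m (fun x y => interp (L ^ m) u f (L ^ m * c.1 + x) (L ^ m * c.2 + y)) ≤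
      2 * ce f c.1 c.2 * (en L A m u + en L A m (fun x y => u y x)) := by
    rw [en, en, en, ← sum_add_distrib, mul_sum]
    refine sum_le_sum fun d hd => ?_
    have hlt := cells_lt h m d hd
    have e : ∀ s ≤ L ^ m, ∀ t ≤ L ^ m, _ := fun s hs t ht =>
      interp_eq (npos h m) u f hsym h0 h1 (i := c.1) (j := c.2) hs ht
    have b : ∀ s t s' t', _ := fun s t s' t' => bil_sq (f c.1 c.2) (f (c.1 + 1) c.2) (f c.1 (c.2 + 1))
      (f (c.1 + 1) (c.2 + 1)) (u s t) (u t s) (u s' t') (u t' s') (hu s' t') (hu t s)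
    have b1 := b d.1 d.2 (d.1 + 1) d.2
    have b2 := b d.1 (d.2 + 1) (d.1 + 1) (d.2 + 1)
    have b3 := b d.1 d.2 d.1 (d.2 + 1)
    have b4 := b (d.1 + 1) d.2 (d.1 + 1) (d.2 + 1)
    rw [← e _ (by omega) _ (by omega), ← e _ (by omega) _ (by omega)] at b1 b2 b3 b4
    unfold ce
    linarith
  rw [en_swap h m u] at key
  linarith

lemma interp_corner {M : ℕ} (hM : 0 < M) (u f : ℕ → ℕ → ℝ) 
    (h0 : ∀ y ≤ M, u 0 y = 1) (i j : ℕ) : interp M u f (M * i) (M * j) = f i j := by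
  have := interp_lt u f (i := i) (j := j) hM hM
  simp only [add_zero] at this
  rw [this, h0 0 hM.le]; simp [bil]

lemma EE_super (h : GoodCarpet L A) (n m : ℕ) :
    EE L A (n + m) ≤ 16 * EE L A n * EB L A m := by
  obtain ⟨u, hu, hsym, h0, h1, h2⟩ := exists_nice h m
  have hp := EE_pos h n
  obtain ⟨e, ⟨f, f0, f1, rfl⟩, h3⟩ := exists_lt_of_csInf_lt (EE_ne h n)
    (show EE L A n < 2 * EE L A n by linarith)
  have k1 := interp_energy h n m u f hu hsym h0 h1
  have k2 := EE_le (A := A) (n + m) (interp (L ^ m) u f)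
    (by simpa using (interp_corner (npos h m) u f h0 0 0).trans f0)
    (by rw [pow_add, mul_comm]; simpa using (interp_corner (npos h m) u f h0 (L ^ n) 0).trans f1)
  have := mul_le_mul h2 h3.le (en_nonneg _ _ _ _) (by linarith [EB_pos h m])
  linarith

lemma dvd_rep {M N y : ℕ} (hN : 0 < N) (hy : y ≤ N * M) :
    ∃ j t, j < N ∧ t ≤ M ∧ y = M * j + t := by
  rcases Nat.eq_zero_or_pos M with rfl | hM
  · exact ⟨0, 0, hN, le_rfl, by simpa using hy⟩
  rcases hy.lt_or_eq with hy' | rfl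
  · refine ⟨y / M, y % M, ?_, (Nat.mod_lt _ hM).le, (Nat.div_add_mod _ _).symm⟩
    exact (Nat.div_lt_iff_lt_mul hM).2 hy'
  · refine ⟨N - 1, M, by omega, le_rfl, ?_⟩
    obtain ⟨k, rfl⟩ : ∃ k, N = k + 1 := ⟨N - 1, by omega⟩
    simp only [Nat.add_sub_cancel]; ring

lemma EB_super (h : GoodCarpet L A) (n m : ℕ) :
    EB L A (n + m) ≤ 16 * EB L A n * EB L A m := by
  obtain ⟨u, hu, hsym, h0, h1, h2⟩ := exists_nice h m
  have hp := EB_pos h n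
  obtain ⟨e, ⟨f, f0, f1, rfl⟩, h3⟩ := exists_lt_of_csInf_lt (EB_ne h n)
    (show EB L A n < 2 * EB L A n by linarith)
  have k1 := interp_energy h n m u f hu hsym h0 h1
  have hM := npos h m
  have k2 := EB_le (A := A) (n + m) (interp (L ^ m) u f)
    (by
      intro y hy
      rw [pow_add] at hy
      obtain ⟨j, t, hj, ht, rfl⟩ := dvd_rep (npos h n) hy
      have := interp_eq hM u f hsym h0 h1 (i := 0) (j := j) (Nat.zero_le _) ht
      simp only [mul_zero, add_zero] at this
      rw [this, h0 t ht, f0 j hj.le, f0 (j + 1) hj]; simp [bil])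
    (by
      intro y hy
      rw [pow_add] at hy
      obtain ⟨j, t, hj, ht, rfl⟩ := dvd_rep (npos h n) hy
      have := interp_eq hM u f hsym h0 h1 (i := L ^ n) (j := j) (Nat.zero_le _) ht
      simp only [add_zero] at this
      rw [pow_add, mul_comm (L ^ n), this, h0 t ht, f1 j hj.le, f1 (j + 1) hj]; simp [bil])
  have := mul_le_mul h2 h3.le (en_nonneg _ _ _ _) (by linarith [EB_pos h m])
  linarith

/-! ### Exponential decay of the conductance -/

lemma card_cells (h : GoodCarpet L A) (n : ℕ) :
    ∑ _c ∈ cells L A n, (1 : ℝ) = (#A : ℝ) ^ n := by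
  induction n with
  | zero => simp [cells]
  | succ n ih => rw [sum_succ h, sum_congr rfl fun a _ => ih]; simp [pow_succ, mul_comm]

lemma EB_decay (h : GoodCarpet L A) (n : ℕ) : EB L A n ≤ 2 * ((#A : ℝ) / (L : ℝ) ^ 2) ^ n := by
  have hL' : (0 : ℝ) < L := by exact_mod_cast lpos h
  have k := EB_le (L := L) (A := A) n (fun x _ => 1 - (x : ℝ) / (L : ℝ) ^ n) (by simp)
    (by intro y _; push_cast; rw [div_self (by positivity)]; ring)
  refine k.trans (le_of_eq ?_)
  have e : ∀ c : ℕ × ℕ, ce (fun x _ => 1 - (x : ℝ) / (L : ℝ) ^ n) c.1 c.2 =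
      2 / ((L : ℝ) ^ 2) ^ n * 1 := by
    intro c
    simp only [ce]; push_cast
    have : ((L : ℝ) ^ 2) ^ n = ((L : ℝ) ^ n) ^ 2 := by rw [← pow_mul, ← pow_mul, mul_comm]
    rw [this]
    field_simp; ring
  rw [en, sum_congr rfl fun c _ => e c, ← mul_sum, card_cells h, div_pow]
  ring

lemma kappa_lt (h : GoodCarpet L A) : (#A : ℝ) / (L : ℝ) ^ 2 < 1 := by
  have hL' : (0 : ℝ) < L := by exact_mod_cast lpos h
  rw [div_lt_one (by positivity)]
  have : #A < #(range L ×ˢ range L) := by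
    refine card_lt_card ?_
    rw [Finset.ssubset_iff_of_subset]
    · obtain ⟨a, b, ha, hb, hab⟩ := h.proper
      exact ⟨(a, b), by simp [ha, hb], hab⟩
    · intro a ha; simpa using h.mem_lt a ha
  rw [card_product, card_range] at this
  rw [pow_two]; exact_mod_cast this

lemma kappa_pos (h : GoodCarpet L A) : 0 < (#A : ℝ) / (L : ℝ) ^ 2 := by
  have hL' : (0 : ℝ) < L := by exact_mod_cast lpos h
  have : 0 < #A := card_pos.2 ⟨(0, 0), h.flat_border _ _ (lpos h) (lpos h) (by simp)⟩
  have : (0 : ℝ) < #A := by exact_mod_cast this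
  positivity
end

/-! ### Lattice walks and the planar crossing lemma -/

/-- Nearest neighbour relation in the lattice. -/
def Nbr (p q : ℕ × ℕ) : Prop :=
  (p.1 = q.1 ∧ (q.2 = p.2 + 1 ∨ p.2 = q.2 + 1)) ∨ (p.2 = q.2 ∧ (q.1 = p.1 + 1 ∨ p.1 = q.1 + 1))

/-- Signed crossing of the half line `{x + 1/2} × (y, ∞)` by a step. -/
def scr (x y : ℕ) (p q : ℕ × ℕ) : ℤ :=
  if p.1 = x ∧ q.1 = x + 1 ∧ y < p.2 then 1
  else if p.1 = x + 1 ∧ q.1 = x ∧ y < p.2 then -1 else 0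

lemma scr_vert {x y : ℕ} {p q : ℕ × ℕ} (hpq : Nbr p q) (h1 : p ≠ (x, y + 1)) (h2 : q ≠ (x, y + 1)) :
    scr x y p q = scr x (y + 1) p q := by
  obtain ⟨a, b⟩ := p
  obtain ⟨c, d⟩ := q
  simp only [Nbr, scr, ne_eq, Prod.mk.injEq] at *
  split_ifs <;> omega

lemma scr_vert' {x y : ℕ} {p q : ℕ × ℕ} (hpq : Nbr p q) (h1 : p ≠ (x + 1, y + 1))
    (h2 : q ≠ (x + 1, y + 1)) :
    scr x y p q = scr x (y + 1) p q := by
  obtain ⟨a, b⟩ := p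
  obtain ⟨c, d⟩ := q
  simp only [Nbr, scr, ne_eq, Prod.mk.injEq] at *
  split_ifs <;> omega

/-- Indicator of a vertical half line. -/
def hl (x y : ℕ) (p : ℕ × ℕ) : ℤ := if p.1 = x ∧ y < p.2 then 1 else 0

lemma scr_horiz {x y : ℕ} {p q : ℕ × ℕ} (hpq : Nbr p q) (h1 : p ≠ (x + 1, y))
    (h2 : q ≠ (x + 1, y)) :
    scr x y p q - scr (x + 1) y p q = hl (x + 1) y q - hl (x + 1) y p := by
  obtain ⟨a, b⟩ := p
  obtain ⟨c, d⟩ := q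
  simp only [Nbr, scr, hl, ne_eq, Prod.mk.injEq] at *
  split_ifs <;> omega

/-- Total signed crossing number. -/
def tot (p : ℕ → ℕ × ℕ) (m x y : ℕ) : ℤ := ∑ i ∈ range m, scr x y (p i) (p (i + 1))

lemma crossing (X Y : ℕ) (hX : 0 < X) (p : ℕ → ℕ × ℕ) (m : ℕ) (hp : ∀ i < m, Nbr (p i) (p (i + 1)))
    (hp0 : (p 0).1 = 0) (hpm : X ≤ (p m).1) (hpY : ∀ i ≤ m, (p i).2 ≤ Y)
    (q : ℕ → ℕ × ℕ) (k : ℕ) (hq : ∀ i < k, Nbr (q i) (q (i + 1)))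
    (hq0 : (q 0).2 = 0) (hqk : (q k).2 = Y) (hqX : ∀ i ≤ k, (q i).1 ≤ X) :
    ∃ i ≤ m, ∃ j ≤ k, p i = q j := by
  by_contra! hcon
  have main : ∀ j ≤ k, tot p m (min (q j).1 (X - 1)) (q j).2 = 1 := by
    intro j
    induction j with
    | zero =>
      intro _
      rw [hq0]
      have hx := hqX 0 (Nat.zero_le _)
      set x := min (q 0).1 (X - 1) with hxd
      have e : tot p m x 0 = ∑ i ∈ range m,
          ((if x < (p (i + 1)).1 then (1 : ℤ) else 0) - (if x < (p i).1 then (1 : ℤ) else 0)) := by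
        refine sum_congr rfl fun i hi => ?_
        have hi := mem_range.1 hi
        have n1 := hcon i hi.le 0 (Nat.zero_le _)
        have n2 := hcon (i + 1) hi 0 (Nat.zero_le _)
        have st := hp i hi
        have hq00 : q 0 = ((q 0).1, 0) := Prod.ext rfl hq0
        rw [hq00] at n1 n2
        generalize p i = a at *
        generalize p (i + 1) = b at *
        generalize (q 0).1 = c at *
        obtain ⟨a, a'⟩ := a
        obtain ⟨b, b'⟩ := b
        simp only [Nbr, scr, ne_eq, Prod.mk.injEq] at *
        split_ifs <;> omega
      rw [e, sum_range_sub (fun i => if x < (p i).1 then (1 : ℤ) else 0)]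
      simp only [hp0]
      rw [if_pos (by omega), if_neg (by omega)]; rfl
    | succ j ih =>
      intro hj
      have ih := ih (by omega)
      rw [← ih]
      have st := hq j (by omega)
      have hx := hqX j (by omega)
      have hx' := hqX (j + 1) hj
      have n1 : ∀ i ≤ m, p i ≠ q j := fun i hi => hcon i hi j (by omega)
      have n2 : ∀ i ≤ m, p i ≠ q (j + 1) := fun i hi => hcon i hi _ hj
      generalize q j = a at *
      generalize q (j + 1) = b at *
      obtain ⟨a, a'⟩ := a
      obtain ⟨b, b'⟩ := b
      simp only [] at hx hx' ⊢
      have vert : ∀ a a', a ≤ X → (∀ i ≤ m, p i ≠ (a, a' + 1)) →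
          tot p m (min a (X - 1)) (a' + 1) = tot p m (min a (X - 1)) a' := by
        intro a a' ha hn
        refine sum_congr rfl fun i hi => ?_
        have hi := mem_range.1 hi
        have n1 := hn i hi.le
        have n2 := hn (i + 1) hi
        rcases Nat.lt_or_ge a X with h | h
        · rw [show min a (X - 1) = a by omega]
          exact (scr_vert (hp i hi) n1 n2).symm
        · obtain rfl : a = X := le_antisymm ha h
          obtain ⟨z, rfl⟩ : ∃ z, a = z + 1 := ⟨a - 1, by omega⟩
          rw [show min (z + 1) (z + 1 - 1) = z by omega]
          exact (scr_vert' (hp i hi) n1 n2).symm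
      have horiz : ∀ a a', a + 1 ≤ X → (∀ i ≤ m, p i ≠ (a + 1, a')) →
          tot p m (min (a + 1) (X - 1)) a' = tot p m (min a (X - 1)) a' := by
        intro a a' ha hn
        rcases Nat.lt_or_ge (a + 1) X with h | h
        · rw [show min a (X - 1) = a by omega, show min (a + 1) (X - 1) = a + 1 by omega]
          rw [eq_comm, ← sub_eq_zero, tot, tot, ← sum_sub_distrib]
          rw [sum_congr rfl fun i hi => scr_horiz (hp i (mem_range.1 hi)) (hn i (mem_range.1 hi).le)
            (hn (i + 1) (mem_range.1 hi)), sum_range_sub (fun i => hl (a + 1) a' (p i))]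
          simp only [hl]
          rw [if_neg (by omega), if_neg (by omega)]; rfl
        · rw [show min a (X - 1) = min (a + 1) (X - 1) by omega]
      simp only [Nbr] at st
      rcases st with ⟨rfl, rfl | rfl⟩ | ⟨rfl, rfl | rfl⟩
      · exact vert _ _ hx n2
      · exact (vert _ _ hx n1).symm
      · exact horiz _ _ hx' n2
      · exact (horiz _ _ hx n1).symm
  have h1 := main k le_rfl
  rw [hqk] at h1
  have h0 : tot p m (min (q k).1 (X - 1)) Y = 0 := by
    refine sum_eq_zero fun i hi => ?_
    have := hpY i (mem_range.1 hi).le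
    unfold scr
    rw [if_neg (by omega), if_neg (by omega)]
  omega

/-! ### Existence of crossings with small oscillation -/

/-- `p` is a corner of the unit cell at `c`. -/
def InC (c p : ℕ × ℕ) : Prop := c.1 ≤ p.1 ∧ p.1 ≤ c.1 + 1 ∧ c.2 ≤ p.2 ∧ p.2 ≤ c.2 + 1

/-- Points reachable from the left side by a walk of given `f`-length. -/
inductive LW {ι : Type} (s : Finset ι) (pos : ι → ℕ × ℕ) (f : ℕ → ℕ → ℝ) (Y : ℕ) :
    ℕ × ℕ → ℝ → Prop
  | start (p : ℕ × ℕ) : p.1 = 0 → p.2 ≤ Y → LW s pos f Y p 0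
  | step (p q : ℕ × ℕ) (t : ℝ) (i : ι) : LW s pos f Y p t → i ∈ s → InC (pos i) p →
      InC (pos i) q → Nbr p q → LW s pos f Y q (t + |f p.1 p.2 - f q.1 q.2|)

section
variable {ι : Type} {s : Finset ι} {pos : ι → ℕ × ℕ} {f : ℕ → ℕ → ℝ} {X Y : ℕ}

lemma LW_nonneg {p : ℕ × ℕ} {t : ℝ} (hw : LW s pos f Y p t) : 0 ≤ t := by
  induction hw with
  | start => exact le_rfl
  | step p q t i _ _ _ _ _ ih => positivity

lemma LW_walk (hpos : ∀ i ∈ s, (pos i).1 < X ∧ (pos i).2 < Y) {p : ℕ × ℕ} {t : ℝ}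
    (hw : LW s pos f Y p t) :
    ∃ (m : ℕ) (w : ℕ → ℕ × ℕ), (w 0).1 = 0 ∧ w m = p ∧ (∀ i < m, Nbr (w i) (w (i + 1))) ∧
      (∀ i ≤ m, (w i).1 ≤ X ∧ (w i).2 ≤ Y) ∧
      (∀ i ≤ m, |f (w i).1 (w i).2 - f p.1 p.2| ≤ t) := by
  induction hw with
  | start p h1 h2 =>
    refine ⟨0, fun _ => p, h1, rfl, by omega, fun _ _ => ⟨?_, h2⟩, fun _ _ => by simp⟩
    show p.1 ≤ X
    omega
  | step p q t i hw hi hp hq hn ih =>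
    obtain ⟨m, w, w0, wm, wn, wb, wf⟩ := ih
    refine ⟨m + 1, fun j => if j ≤ m then w j else q, by simpa using w0, by simp, ?_, ?_, ?_⟩
    · intro j hj
      rcases Nat.lt_or_ge j m with h | h
      · simp only [h.le, if_true, Nat.succ_le_of_lt h]
        exact wn j h
      · obtain rfl : j = m := by omega
        simp [wm, hn]
    · intro j hj
      dsimp only
      split_ifs with h
      · exact wb j h
      · have := hpos i hi
        unfold InC at hq
        omega
    · intro j hj
      dsimp only
      split_ifs with h
      · have h1 := wf j h
        have h2 := abs_sub_le (f (w j).1 (w j).2) (f p.1 p.2) (f q.1 q.2)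
        linarith
      · have := LW_nonneg hw
        simp only [sub_self, abs_zero]; positivity

lemma LW_exists (κ T : ℝ) (hT : 0 < T)
    (hκ : ∀ u : ℕ → ℕ → ℝ, (∀ y ≤ Y, u 0 y = 1) → (∀ y ≤ Y, u X y = 0) →
      κ ≤ ∑ i ∈ s, ce u (pos i).1 (pos i).2)
    (hf : ∑ i ∈ s, ce f (pos i).1 (pos i).2 < T ^ 2 * κ) :
    ∃ y ≤ Y, ∃ t < T, LW s pos f Y (X, y) t := by
  by_contra! hcon
  set S : ℕ → ℕ → Set ℝ := fun x y => insert T {t | LW s pos f Y (x, y) t} with hS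
  set d : ℕ → ℕ → ℝ := fun x y => sInf (S x y) with hd
  have hne : ∀ x y, (S x y).Nonempty := fun x y => ⟨T, Set.mem_insert _ _⟩
  have hlb : ∀ x y, ∀ t ∈ S x y, 0 ≤ t := by
    intro x y t ht
    rcases ht with rfl | ht
    · exact hT.le
    · exact LW_nonneg ht
  have hbd : ∀ x y, BddBelow (S x y) := fun x y => ⟨0, hlb x y⟩
  have d0 : ∀ y ≤ Y, d 0 y = 0 := fun y hy => le_antisymm
    (csInf_le (hbd _ _) (Set.mem_insert_of_mem _ (LW.start (0, y) rfl hy)))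
    (le_csInf (hne _ _) (hlb _ _))
  have dX : ∀ y ≤ Y, d X y = T := fun y hy => le_antisymm
    (csInf_le (hbd _ _) (Set.mem_insert _ _))
    (le_csInf (hne _ _) (by
      intro t ht
      rcases ht with rfl | ht
      · exact le_rfl
      · by_contra! hlt
        exact hcon y hy t hlt ht))
  have step : ∀ i ∈ s, ∀ p q : ℕ × ℕ, InC (pos i) p → InC (pos i) q → Nbr p q →
      d q.1 q.2 ≤ d p.1 p.2 + |f p.1 p.2 - f q.1 q.2| := by
    intro i hi p q hp hq hn
    rw [← sub_le_iff_le_add]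
    refine le_csInf (hne _ _) ?_
    intro t ht
    rw [sub_le_iff_le_add]
    rcases ht with rfl | ht
    · exact (csInf_le (hbd _ _) (Set.mem_insert _ _)).trans (by linarith [abs_nonneg (f p.1 p.2 - f q.1 q.2)])
    · exact csInf_le (hbd _ _) (Set.mem_insert_of_mem _ (LW.step p q t i ht hi hp hq hn))
  have lip : ∀ i ∈ s, ∀ p q : ℕ × ℕ, InC (pos i) p → InC (pos i) q → Nbr p q → Nbr q p → 
      (d p.1 p.2 - d q.1 q.2) ^ 2 ≤ (f p.1 p.2 - f q.1 q.2) ^ 2 := by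
    intro i hi p q hp hq hn hn'
    have h1 := step i hi p q hp hq hn
    have h2 := step i hi q p hq hp hn'
    rw [abs_sub_comm] at h2
    exact sq_le_sq.2 (abs_le.2 ⟨by linarith, by linarith⟩)
  have hce : ∀ i ∈ s, ce d (pos i).1 (pos i).2 ≤ ce f (pos i).1 (pos i).2 := by
    intro i hi
    set a := (pos i).1 with ha
    set b := (pos i).2 with hb
    have k1 := lip i hi (a, b) (a + 1, b) (by simp [InC, ← ha, ← hb]) (by simp [InC, ← ha, ← hb])
      (by simp [Nbr]) (by simp [Nbr])
    have k2 := lip i hi (a, b + 1) (a + 1, b + 1) (by simp [InC, ← ha, ← hb])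
      (by simp [InC, ← ha, ← hb]) (by simp [Nbr]) (by simp [Nbr])
    have k3 := lip i hi (a, b) (a, b + 1) (by simp [InC, ← ha, ← hb]) (by simp [InC, ← ha, ← hb])
      (by simp [Nbr]) (by simp [Nbr])
    have k4 := lip i hi (a + 1, b) (a + 1, b + 1) (by simp [InC, ← ha, ← hb])
      (by simp [InC, ← ha, ← hb]) (by simp [Nbr]) (by simp [Nbr])
    simp only at k1 k2 k3 k4
    unfold ce
    linarith
  have h1 := hκ (fun x y => 1 - T⁻¹ * d x y) (fun y hy => by simp [d0 y hy])
    (fun y hy => by simp [dX y hy, hT.ne'])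
  have h2 : ∑ i ∈ s, ce (fun x y => 1 - T⁻¹ * d x y) (pos i).1 (pos i).2 ≤
      T⁻¹ ^ 2 * ∑ i ∈ s, ce f (pos i).1 (pos i).2 := by
    rw [mul_sum]
    refine sum_le_sum fun i hi => ?_
    have e : ce (fun x y => 1 - T⁻¹ * d x y) (pos i).1 (pos i).2 =
        T⁻¹ ^ 2 * ce d (pos i).1 (pos i).2 := by unfold ce; ring
    rw [e]
    exact mul_le_mul_of_nonneg_left (hce i hi) (by positivity)
  have h3 : T⁻¹ ^ 2 * ∑ i ∈ s, ce f (pos i).1 (pos i).2 < T⁻¹ ^ 2 * (T ^ 2 * κ) :=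
    mul_lt_mul_of_pos_left hf (by positivity)
  have h4 : T⁻¹ ^ 2 * (T ^ 2 * κ) = κ := by field_simp
  linarith

/-- A lattice walk from left to right in `[0,X] × [0,Y]` with small oscillation of `f`. -/
def HWalk (X Y : ℕ) (f : ℕ → ℕ → ℝ) (O : ℝ) (m : ℕ) (w : ℕ → ℕ × ℕ) : Prop :=
  (w 0).1 = 0 ∧ (w m).1 = X ∧ (∀ i < m, Nbr (w i) (w (i + 1))) ∧
    (∀ i ≤ m, (w i).1 ≤ X ∧ (w i).2 ≤ Y) ∧
    (∀ i ≤ m, ∀ j ≤ m, |f (w i).1 (w i).2 - f (w j).1 (w j).2| ≤ O)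

/-- A lattice walk from bottom to top in `[0,X] × [0,Y]` with small oscillation of `f`. -/
def VWalk (X Y : ℕ) (f : ℕ → ℕ → ℝ) (O : ℝ) (m : ℕ) (w : ℕ → ℕ × ℕ) : Prop :=
  (w 0).2 = 0 ∧ (w m).2 = Y ∧ (∀ i < m, Nbr (w i) (w (i + 1))) ∧
    (∀ i ≤ m, (w i).1 ≤ X ∧ (w i).2 ≤ Y) ∧
    (∀ i ≤ m, ∀ j ≤ m, |f (w i).1 (w i).2 - f (w j).1 (w j).2| ≤ O)

lemma HWalk_exists (κ T : ℝ) (hT : 0 < T)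
    (hpos : ∀ i ∈ s, (pos i).1 < X ∧ (pos i).2 < Y)
    (hκ : ∀ u : ℕ → ℕ → ℝ, (∀ y ≤ Y, u 0 y = 1) → (∀ y ≤ Y, u X y = 0) →
      κ ≤ ∑ i ∈ s, ce u (pos i).1 (pos i).2)
    (hf : ∑ i ∈ s, ce f (pos i).1 (pos i).2 < T ^ 2 * κ) :
    ∃ m w, HWalk X Y f (2 * T) m w := by
  obtain ⟨y, hy, t, ht, hw⟩ := LW_exists κ T hT hκ hf
  obtain ⟨m, w, w0, wm, wn, wb, wf⟩ := LW_walk hpos hw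
  refine ⟨m, w, w0, by rw [wm], wn, wb, ?_⟩
  intro i hi j hj
  have h1 := wf i hi
  have h2 := wf j hj
  rw [abs_sub_comm] at h2
  have := abs_sub_le (f (w i).1 (w i).2) (f X y) (f (w j).1 (w j).2)
  simp only at h1 h2
  linarith

lemma HV_meet (hX : 0 < X) {X' Y' m k : ℕ} {O O' : ℝ} {p q : ℕ → ℕ × ℕ} {g : ℕ → ℕ → ℝ}
    (hXX : X ≤ X') (hYY : Y' ≤ Y) (hp : HWalk X' Y' f O m p) (hq : VWalk X Y g O' k q) :
    ∃ i ≤ m, ∃ j ≤ k, p i = q j := by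
  obtain ⟨p0, pm, pn, pb, _⟩ := hp
  obtain ⟨q0, qk, qn, qb, _⟩ := hq
  exact crossing X Y hX p m pn p0 (by omega) (fun i hi => (pb i hi).2.trans hYY) q k qn q0 qk
    (fun i hi => (qb i hi).1)
end

section
variable {L : ℕ} {A : Finset (ℕ × ℕ)}

lemma HWalk_square (h : GoodCarpet L A) (n : ℕ) (f : ℕ → ℕ → ℝ) (T : ℝ) (hT : 0 < T)
    (hf : en L A n f < T ^ 2 * EB L A n) : ∃ m w, HWalk (L ^ n) (L ^ n) f (2 * T) m w :=
  HWalk_exists (s := cells L A n) (pos := id) (EB L A n) T hT (cells_lt h n)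
    (fun u h0 h1 => EB_le n u h0 h1) hf

lemma VWalk_square (h : GoodCarpet L A) (n : ℕ) (f : ℕ → ℕ → ℝ) (T : ℝ) (hT : 0 < T)
    (hf : en L A n f < T ^ 2 * EB L A n) : ∃ m w, VWalk (L ^ n) (L ^ n) f (2 * T) m w := by
  obtain ⟨m, w, h0, h1, h2, h3, h4⟩ := HWalk_square h n (fun x y => f y x) T hT
    (by rwa [en_swap h])
  refine ⟨m, fun i => ((w i).2, (w i).1), h0, h1, ?_, fun i hi => ⟨(h3 i hi).2, (h3 i hi).1⟩, h4⟩
  intro i hi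
  have := h2 i hi
  simp only [Nbr] at this ⊢
  tauto

lemma en_sum (n k : ℕ) (F : ℕ → ℕ → ℕ → ℝ) :
    en L A n (fun x y => ∑ i ∈ range k, F i x y) ≤ k * ∑ i ∈ range k, en L A n (F i) := by
  unfold en
  rw [sum_comm, mul_sum]
  refine sum_le_sum fun c _ => ?_
  have key : ∀ x y x' y', (∑ i ∈ range k, F i x y - ∑ i ∈ range k, F i x' y') ^ 2 ≤
      k * ∑ i ∈ range k, (F i x y - F i x' y') ^ 2 := by
    intro x y x' y'
    rw [← sum_sub_distrib]
    have := sq_sum_le_card_mul_sum_sq (s := range k) (f := fun i => F i x y - F i x' y')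
    rwa [card_range] at this
  unfold ce
  simp only [sum_add_distrib, mul_add]
  have k1 := key c.1 c.2 (c.1 + 1) c.2
  have k2 := key c.1 (c.2 + 1) (c.1 + 1) (c.2 + 1)
  have k3 := key c.1 c.2 c.1 (c.2 + 1)
  have k4 := key (c.1 + 1) c.2 (c.1 + 1) (c.2 + 1)
  linarith

lemma alt_sum_left (F : ℕ → ℝ) (k : ℕ) :
    ∑ i ∈ range k, (-1 : ℝ) ^ i * F (if Even i then i else i + 1) =
      F 0 - if Even k then F k else 0 := by
  induction k with
  | zero => simp
  | succ k ih =>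
    rw [sum_range_succ, ih]
    rcases Nat.even_or_odd k with hk | hk
    · simp [hk, Nat.even_add_one]
    · have : ¬ Even k := Nat.not_even_iff_odd.2 hk
      simp [this, Nat.even_add_one, hk.neg_one_pow]; ring

lemma alt_sum_right (F : ℕ → ℝ) (k : ℕ) :
    ∑ i ∈ range k, (-1 : ℝ) ^ i * F (if Even i then i + 1 else i) =
      if Even k then 0 else F k := by
  induction k with
  | zero => simp
  | succ k ih =>
    rw [sum_range_succ, ih]
    rcases Nat.even_or_odd k with hk | hk
    · simp [hk, Nat.even_add_one]
    · have : ¬ Even k := Nat.not_even_iff_odd.2 hk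
      simp [this, Nat.even_add_one, hk.neg_one_pow]

lemma strip_cond (h : GoodCarpet L A) (n : ℕ) (u : ℕ → ℕ → ℝ) (h0 : ∀ y ≤ L ^ n, u 0 y = 1)
    (h1 : ∀ y ≤ L ^ n, u (L ^ (n + 1)) y = 0) :
    EB L A n ≤ L * ∑ i ∈ range L, en L A n (fun x y => u (L ^ n * i + x) y) := by
  set F : ℕ → ℕ → ℕ → ℝ := fun i x y =>
    (-1 : ℝ) ^ i * u (L ^ n * i + (if Even i then x else L ^ n - x)) y with hF
  have e : ∀ i, en L A n (F i) = en L A n (fun x y => u (L ^ n * i + x) y) := by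
    intro i
    have k1 := en_affine (L := L) (A := A) n
      (fun x y => u (L ^ n * i + (if Even i then x else L ^ n - x)) y) ((-1 : ℝ) ^ i) 0
    simp only [add_zero] at k1
    rw [hF, k1, ← pow_mul, mul_comm i 2, pow_mul]
    norm_num
    split_ifs
    · rfl
    · exact en_refl h n (fun x y => u (L ^ n * i + x) y)
  have k := EB_le (L := L) (A := A) n (fun x y => ∑ i ∈ range L, F i x y)
    (by
      intro y hy
      have := alt_sum_left (fun i => u (L ^ n * i) y) L
      simp only [mul_zero, h0 y hy, ← pow_succ, h1 y hy, ite_self, sub_zero] at this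
      rw [← this]
      refine sum_congr rfl fun i _ => ?_
      simp only [hF]
      split_ifs
      · simp
      · simp [mul_add])
    (by
      intro y hy
      have := alt_sum_right (fun i => u (L ^ n * i) y) L
      simp only [← pow_succ, h1 y hy, ite_self] at this
      rw [← this]
      refine sum_congr rfl fun i _ => ?_
      simp only [hF]
      split_ifs
      · simp [mul_add]
      · simp)
  refine k.trans ((en_sum n L F).trans (le_of_eq ?_))
  rw [sum_congr rfl fun i _ => e i]

lemma strip_le (h : GoodCarpet L A) (n : ℕ) (f : ℕ → ℕ → ℝ) :
    ∑ i ∈ range L, en L A n (fun x y => f (L ^ n * i + x) y) ≤ en L A (n + 1) f := by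
  have := sum_bottom h
    (fun a => en L A n (fun x y => f (L ^ n * a.1 + x) (L ^ n * a.2 + y)))
    (fun _ => en_nonneg _ _ _ _)
  simp only [mul_zero, zero_add] at this
  refine this.trans (le_of_eq ?_)
  unfold en
  rw [sum_succ h]
  rfl

lemma en_corner_le (h : GoodCarpet L A) (n : ℕ) (f : ℕ → ℕ → ℝ) :
    en L A n f ≤ en L A (n + 1) f := by
  refine le_trans ?_ (strip_le h n f)
  have := single_le_sum (s := range L) (f := fun i => en L A n (fun x y => f (L ^ n * i + x) y))
    (fun _ _ => en_nonneg _ _ _ _) (mem_range.2 (lpos h))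
  simpa using this

lemma HWalk_strip (h : GoodCarpet L A) (n : ℕ) (f : ℕ → ℕ → ℝ) (T : ℝ) (hT : 0 < T)
    (hf : en L A (n + 1) f < T ^ 2 * (EB L A n / L)) :
    ∃ m w, HWalk (L ^ (n + 1)) (L ^ n) f (2 * T) m w := by
  have hL' : (0 : ℝ) < L := by exact_mod_cast lpos h
  refine HWalk_exists (s := range L ×ˢ cells L A n)
    (pos := fun x => (L ^ n * x.1 + x.2.1, x.2.2)) (EB L A n / L) T hT ?_ ?_ ?_
  · rintro ⟨i, d⟩ hx
    simp only [mem_product, mem_range] at hx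
    have h2 := cells_lt h n d hx.2
    have e1 : L ^ n * (i + 1) ≤ L ^ n * L := Nat.mul_le_mul_left _ hx.1
    simp only [pow_succ]
    constructor
    · nlinarith
    · exact h2.2
  · intro u h0 h1
    have := strip_cond h n u h0 h1
    rw [div_le_iff₀' hL', sum_product]
    exact this
  · rw [sum_product]
    exact lt_of_le_of_lt (strip_le h n f) hf

lemma chain (h : GoodCarpet L A) (n : ℕ) : ∀ (f : ℕ → ℕ → ℝ) (Δ : ℝ), 0 < Δ → en L A n f < Δ →
    ∀ (m : ℕ) (w : ℕ → ℕ × ℕ) (O : ℝ), VWalk (L ^ n) (L ^ n) f O m w → ∀ i ≤ m,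
      |f (w i).1 (w i).2 - f 0 0| ≤
        O + √Δ * (2 + 4 * √L * ∑ j ∈ range n, 1 / √(EB L A j)) := by
  have hL' : (1 : ℝ) ≤ L := by exact_mod_cast lpos h
  induction n with
  | zero =>
    intro f Δ hΔ hf m w O hw i hi
    have hO : 0 ≤ O := (abs_nonneg _).trans (hw.2.2.2.2 i hi i hi)
    have hb := hw.2.2.2.1 i hi
    simp only [pow_zero] at hb
    have hf' : (f 0 0 - f 1 0) ^ 2 + (f 0 1 - f 1 1) ^ 2 + (f 0 0 - f 0 1) ^ 2 +
        (f 1 0 - f 1 1) ^ 2 < Δ := by simpa [en, cells, ce] using hf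
    have hs : ∀ z : ℝ, z ^ 2 ≤ Δ → |z| ≤ √Δ := fun z hz => Real.abs_le_sqrt hz
    have s1 := hs (f 0 0 - f 1 0) (by nlinarith)
    have s3 := hs (f 0 0 - f 0 1) (by nlinarith)
    have s4 := hs (f 1 0 - f 1 1) (by nlinarith)
    have hsq := Real.sqrt_nonneg Δ
    simp only [range_zero, sum_empty, mul_zero, add_zero]
    rw [abs_le] at *
    generalize w i = z at *
    obtain ⟨a, b⟩ := z
    simp only at hb ⊢
    obtain ⟨ha, hb⟩ := hb
    interval_cases a <;> interval_cases b <;> constructor <;> linarith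
  | succ n ih =>
    intro f Δ hΔ hf m w O hw i hi
    have hE := EB_pos h n
    set T := √Δ * (√L * (1 / √(EB L A n))) with hTd
    have hsE : 0 < √(EB L A n) := Real.sqrt_pos.2 hE
    have hsΔ : 0 < √Δ := Real.sqrt_pos.2 hΔ
    have hsL : 1 ≤ √(L : ℝ) := Real.one_le_sqrt.2 hL'
    have hT : 0 < T := by positivity
    have hT2 : T ^ 2 * (EB L A n / L) = Δ := by
      rw [hTd, mul_pow, mul_pow, div_pow, Real.sq_sqrt hΔ.le, Real.sq_sqrt (by linarith),
        Real.sq_sqrt hE.le]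
      field_simp
    obtain ⟨mH, wH, hH⟩ := HWalk_strip h n f T hT (by rwa [hT2])
    have hf1 : en L A n f < Δ := lt_of_le_of_lt (en_corner_le h n f) hf
    have hT3 : Δ ≤ T ^ 2 * EB L A n := by
      rw [← hT2]
      exact mul_le_mul_of_nonneg_left (div_le_self hE.le hL') (sq_nonneg _)
    obtain ⟨mV, wV, hV⟩ := VWalk_square h n f T hT (by linarith)
    obtain ⟨a, ha, b, hb, e1⟩ := HV_meet (npos h (n + 1)) le_rfl
      (Nat.pow_le_pow_right (lpos h) (Nat.le_succ n)) hH hw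
    obtain ⟨c, hc, d, hd, e2⟩ := HV_meet (npos h n)
      (Nat.pow_le_pow_right (lpos h) (Nat.le_succ n)) le_rfl hH hV
    have k1 := hw.2.2.2.2 i hi b hb
    have k2 := hH.2.2.2.2 a ha c hc
    have k3 := ih f Δ hΔ hf1 mV wV (2 * T) hV d hd
    rw [← e1] at k1
    rw [← e2] at k3
    have k4 := abs_sub_le (f (w i).1 (w i).2) (f (wH a).1 (wH a).2) (f 0 0)
    have k5 := abs_sub_le (f (wH a).1 (wH a).2) (f (wH c).1 (wH c).2) (f 0 0)
    rw [sum_range_succ]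
    have : √Δ * (2 + 4 * √L * (∑ j ∈ range n, 1 / √(EB L A j) + 1 / √(EB L A n))) =
        √Δ * (2 + 4 * √L * (∑ j ∈ range n, 1 / √(EB L A j))) + 4 * T := by
      rw [hTd]; ring
    rw [this]
    linarith

lemma sum_bound (h : GoodCarpet L A) : ∃ C : ℝ, 0 ≤ C ∧ ∀ n,
    2 + 4 * √L * ∑ j ∈ range n, 1 / √(EB L A j) ≤ C * (1 / √(EB L A n)) := by
  set κ := (#A : ℝ) / (L : ℝ) ^ 2 with hκ
  have hκ0 : 0 < κ := kappa_pos h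
  have hκ1 : κ < 1 := kappa_lt h
  set θ := √κ with hθ
  have hθ0 : 0 ≤ θ := Real.sqrt_nonneg _
  have hθ1 : θ < 1 := by rw [hθ, Real.sqrt_lt' one_pos]; linarith
  have hsub : 0 < 1 - θ := by linarith
  refine ⟨2 * √2 + 4 * √L * (√32 * (1 - θ)⁻¹), by positivity, fun n => ?_⟩
  have hE := EB_pos h n
  have hsE : 0 < √(EB L A n) := Real.sqrt_pos.2 hE
  have h1 : 1 ≤ √2 * (1 / √(EB L A n)) := by
    rw [mul_one_div, one_le_div hsE]
    refine Real.sqrt_le_sqrt ((EB_decay h n).trans ?_)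
    have : κ ^ n ≤ 1 := pow_le_one₀ hκ0.le hκ1.le
    linarith
  have h2 : ∀ j ∈ range n, 1 / √(EB L A j) ≤ √32 * (1 / √(EB L A n)) * θ ^ (n - 1 - j) := by
    intro j hj
    have hj := mem_range.1 hj
    have hEj := EB_pos h j
    have hsEj : 0 < √(EB L A j) := Real.sqrt_pos.2 hEj
    have a1 := EB_super h j (n - j)
    rw [show j + (n - j) = n by omega] at a1
    have a2 := EB_decay h (n - j)
    have a3 : κ ^ (n - j) ≤ κ ^ (n - 1 - j) := pow_le_pow_of_le_one hκ0.le hκ1.le (by omega)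
    have a4 : EB L A n ≤ 32 * κ ^ (n - 1 - j) * EB L A j := by
      calc EB L A n ≤ 16 * EB L A j * EB L A (n - j) := a1
        _ ≤ 16 * EB L A j * (2 * κ ^ (n - 1 - j)) := by
          refine mul_le_mul_of_nonneg_left ?_ (by positivity)
          linarith
        _ = _ := by ring
    have a5 : √(EB L A n) ≤ √32 * θ ^ (n - 1 - j) * √(EB L A j) := by
      have := Real.sqrt_le_sqrt a4
      rw [Real.sqrt_mul (by positivity), Real.sqrt_mul (by positivity)] at this
      rwa [show √(κ ^ (n - 1 - j)) = θ ^ (n - 1 - j) from by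
        rw [← Real.mul_self_sqrt hκ0.le, ← hθ, mul_pow]
        exact Real.sqrt_mul_self (by positivity)] at this
    rw [div_le_iff₀ hsEj]
    calc (1 : ℝ) = √(EB L A n) * (1 / √(EB L A n)) := by field_simp
      _ ≤ √32 * θ ^ (n - 1 - j) * √(EB L A j) * (1 / √(EB L A n)) := by gcongr
      _ = _ := by ring
  have h3 : ∑ j ∈ range n, 1 / √(EB L A j) ≤ √32 * (1 / √(EB L A n)) * (1 - θ)⁻¹ := by
    refine (sum_le_sum h2).trans ?_
    rw [← mul_sum, sum_range_reflect (fun k => θ ^ k) n]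
    refine mul_le_mul_of_nonneg_left ?_ (by positivity)
    have hs := (summable_geometric_of_lt_one hθ0 hθ1).sum_le_tsum (range n)
      (fun i _ => pow_nonneg hθ0 i)
    rwa [tsum_geometric_of_lt_one hθ0 hθ1] at hs
  have h4 := mul_le_mul_of_nonneg_left h3 (show (0 : ℝ) ≤ 4 * √L by positivity)
  nlinarith

lemma VWalk_refl {N m : ℕ} {f : ℕ → ℕ → ℝ} {O : ℝ} {w : ℕ → ℕ × ℕ} (hw : VWalk N N f O m w) :
    VWalk N N (fun x y => f (N - x) y) O m (fun i => (N - (w i).1, (w i).2)) := by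
  obtain ⟨h0, h1, h2, h3, h4⟩ := hw
  refine ⟨h0, h1, ?_, ?_, ?_⟩
  · intro i hi
    have a := h2 i hi
    have b := h3 i hi.le
    have c := h3 (i + 1) hi
    simp only [Nbr] at a ⊢
    omega
  · intro i hi
    exact ⟨Nat.sub_le _ _, (h3 i hi).2⟩
  · intro i hi j hj
    have b := h3 i hi
    have c := h3 j hj
    simp only [Nat.sub_sub_self b.1, Nat.sub_sub_self c.1]
    exact h4 i hi j hj

lemma EB_le_EE (h : GoodCarpet L A) : ∃ K : ℝ, 0 < K ∧ ∀ n, EB L A n ≤ K * EE L A n := by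
  obtain ⟨C, hC, hsum⟩ := sum_bound h
  refine ⟨(4 + 2 * C) ^ 2, by positivity, fun n => ?_⟩
  have hK : (0 : ℝ) < (4 + 2 * C) ^ 2 := by positivity
  rw [← div_le_iff₀' hK]
  refine le_csInf (EE_ne h n) ?_
  rintro e ⟨f, f0, f1, rfl⟩
  refine le_of_forall_gt_imp_ge_of_dense fun Δ hΔ => ?_
  have hΔ0 : 0 < Δ := lt_of_le_of_lt (en_nonneg _ _ _ _) hΔ
  have hE := EB_pos h n
  have hsE : 0 < √(EB L A n) := Real.sqrt_pos.2 hE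
  have hsΔ : 0 < √Δ := Real.sqrt_pos.2 hΔ0
  set a := 1 / √(EB L A n) with ha
  have ha0 : 0 < a := by positivity
  have ha2 : a ^ 2 * EB L A n = 1 := by
    rw [ha, div_pow, Real.sq_sqrt hE.le]; field_simp
  obtain ⟨m, w, hw⟩ := VWalk_square h n f (√Δ * a) (by positivity)
    (by rw [mul_pow, mul_assoc, ha2, Real.sq_sqrt hΔ0.le]; linarith)
  have k1 := chain h n f Δ hΔ0 hΔ m w _ hw 0 (Nat.zero_le _)
  have k2 := chain h n _ Δ hΔ0 (by rwa [en_refl h]) m _ _ (VWalk_refl hw) 0 (Nat.zero_le _)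
  have hb := hw.2.2.2.1 0 (Nat.zero_le _)
  simp only [Nat.sub_sub_self hb.1, Nat.sub_zero, f1] at k2
  rw [f0] at k1
  have k3 := mul_le_mul_of_nonneg_left (hsum n) hsΔ.le
  rw [← ha] at k3
  have k4 : 1 ≤ √Δ * (a * (4 + 2 * C)) := by
    rw [abs_le] at k1 k2
    nlinarith
  have k5 : 1 ≤ Δ * (a ^ 2 * (4 + 2 * C) ^ 2) := by
    have : 1 ≤ (√Δ * (a * (4 + 2 * C))) ^ 2 := one_le_pow₀ k4
    rwa [mul_pow, mul_pow, Real.sq_sqrt hΔ0.le] at this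
  rw [div_le_iff₀ hK]
  calc EB L A n = EB L A n * 1 := by ring
    _ ≤ EB L A n * (Δ * (a ^ 2 * (4 + 2 * C) ^ 2)) := by gcongr
    _ = (a ^ 2 * EB L A n) * (Δ * (4 + 2 * C) ^ 2) := by ring
    _ = _ := by rw [ha2]; ring
end

/-! ### From words to integer cells -/

/-- Integer position of the cell of a word. -/
def wpos (L : ℕ) {A : Finset (ℕ × ℕ)} : (n : ℕ) → Word A n → ℕ × ℕ
  | 0, _ => (0, 0)
  | n + 1, w => (L ^ n * (w 0).1.1 + (wpos L n (Fin.tail w)).1,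
      L ^ n * (w 0).1.2 + (wpos L n (Fin.tail w)).2)

section
variable {L : ℕ} {A : Finset (ℕ × ℕ)}

lemma PsiW_eq (h : GoodCarpet L A) (n : ℕ) (w : Word A n) (p : ℝ × ℝ) :
    PsiW L w p = ((p.1 + (wpos L n w).1) / (L : ℝ) ^ n, (p.2 + (wpos L n w).2) / (L : ℝ) ^ n) := by
  have hL : (L : ℝ) ≠ 0 := by have := lpos h; positivity
  induction n with
  | zero => simp [PsiW, wpos]
  | succ n ih =>
    have e : PsiW L w p = Psi L (w 0).1 (PsiW L (Fin.tail w) p) := by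
      simp only [PsiW, List.ofFn_succ, List.foldr_cons, Function.comp_apply]
      rfl
    rw [e, ih]
    simp only [Psi, wpos, Nat.cast_add, Nat.cast_mul, Nat.cast_pow, Prod.mk.injEq]
    constructor <;> field_simp <;> ring

lemma sum_words (h : GoodCarpet L A) (n : ℕ) (g : ℕ × ℕ → ℝ) :
    ∑ w : Word A n, g (wpos L n w) = ∑ c ∈ cells L A n, g c := by
  induction n generalizing g with
  | zero => simp [wpos, cells]
  | succ n ih =>
    rw [sum_succ h, ← (Fin.consEquiv (fun _ : Fin (n + 1) => {p : ℕ × ℕ // p ∈ A})).sum_comp,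
      Fintype.sum_prod_type, ← sum_coe_sort A]
    refine sum_congr rfl fun a _ => ?_
    rw [← ih (fun d => g (L ^ n * a.1.1 + d.1, L ^ n * a.1.2 + d.2))]
    rfl

lemma wpos_lt (h : GoodCarpet L A) (n : ℕ) (w : Word A n) :
    (wpos L n w).1 < L ^ n ∧ (wpos L n w).2 < L ^ n := by
  induction n with
  | zero => simp [wpos]
  | succ n ih =>
    have h1 := ih (Fin.tail w)
    have h2 := h.mem_lt _ (w 0).2
    simp only [wpos, pow_succ]
    constructor <;> nlinarith

lemma wpos_inj (h : GoodCarpet L A) (n : ℕ) : Function.Injective (wpos L (A := A) n) := by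
  induction n with
  | zero => intro a b _; exact Subsingleton.elim _ _
  | succ n ih =>
    intro a b e
    simp only [wpos, Prod.mk.injEq] at e
    have ha := wpos_lt h n (Fin.tail a)
    have hb := wpos_lt h n (Fin.tail b)
    have e1 := dm_inj ha.1 hb.1 e.1
    have e2 := dm_inj ha.2 hb.2 e.2
    have e3 := ih (Prod.ext e1.2 e2.2)
    have e4 : a 0 = b 0 := Subtype.ext (Prod.ext e1.1 e2.1)
    rw [← Fin.cons_self_tail a, ← Fin.cons_self_tail b, e3, e4]

lemma PsiW_inj (h : GoodCarpet L A) (n : ℕ) (p : ℝ × ℝ) :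
    Function.Injective (fun w : Word A n => PsiW L w p) := by
  intro a b e
  have hL : (L : ℝ) ^ n ≠ 0 := by have := lpos h; positivity
  simp only [PsiW_eq h, Prod.mk.injEq, div_left_inj' hL, add_right_inj, Nat.cast_inj] at e
  exact wpos_inj h n (Prod.ext e.1 e.2)

/-- Ordered adjacent pairs. -/
noncomputable def AP (L : ℕ) (A : Finset (ℕ × ℕ)) (n : ℕ) : Finset ((ℝ × ℝ) × (ℝ × ℝ)) :=
  (VN L A n ×ˢ VN L A n).filter fun z => Adj L A n z.1 z.2

lemma Dform_eq (n : ℕ) (F : ℝ × ℝ → ℝ) :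
    Dform L A n F = (1 / 2) * ∑ z ∈ AP L A n, (F z.1 - F z.2) ^ 2 := by
  rw [Dform, AP, sum_filter, sum_product]

lemma PsiW_mem (n : ℕ) (w : Word A n) {p : ℝ × ℝ} (hp : p ∈ V0) : PsiW L w p ∈ VN L A n := by
  simp only [VN, mem_biUnion, mem_univ, true_and, mem_image]
  exact ⟨w, p, hp, rfl⟩

lemma piece_le (h : GoodCarpet L A) (n : ℕ) (F : ℝ × ℝ → ℝ) {p q : ℝ × ℝ} (hp : p ∈ V0)
    (hq : q ∈ V0) (hpq : eudist p q = 1) :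
    ∑ w : Word A n, (F (PsiW L w p) - F (PsiW L w q)) ^ 2 ≤ 2 * Dform L A n F := by
  rw [Dform_eq]
  have e : ∑ w : Word A n, (F (PsiW L w p) - F (PsiW L w q)) ^ 2 =
      ∑ z ∈ (univ : Finset (Word A n)).image (fun w => (PsiW L w p, PsiW L w q)),
        (F z.1 - F z.2) ^ 2 := by
    rw [sum_image]
    intro a _ b _ e
    simp only [Prod.mk.injEq] at e
    exact PsiW_inj h n p e.1
  rw [e]
  have : ∑ z ∈ (univ : Finset (Word A n)).image (fun w => (PsiW L w p, PsiW L w q)),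
        (F z.1 - F z.2) ^ 2 ≤ ∑ z ∈ AP L A n, (F z.1 - F z.2) ^ 2 := by
    refine sum_le_sum_of_subset_of_nonneg ?_ (fun _ _ _ => sq_nonneg _)
    intro z hz
    simp only [mem_image, mem_univ, true_and] at hz
    obtain ⟨w, rfl⟩ := hz
    simp only [AP, mem_filter, mem_product]
    exact ⟨⟨PsiW_mem n w hp, PsiW_mem n w hq⟩, w, p, hp, q, hq, hpq, rfl, rfl⟩
  linarith

/-- Restriction of a function on the plane to the integer grid. -/
noncomputable def grid (L n : ℕ) (F : ℝ × ℝ → ℝ) (i j : ℕ) : ℝ :=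
  F ((i : ℝ) / (L : ℝ) ^ n, (j : ℝ) / (L : ℝ) ^ n)

lemma V0_dist (p q : ℝ × ℝ) (hp : p ∈ V0) (hq : q ∈ V0)
    (hpq : eudist p q = 1) :
    (p = (0,0) ∧ q = (1,0)) ∨ (p = (1,0) ∧ q = (0,0)) ∨ (p = (0,1) ∧ q = (1,1)) ∨
    (p = (1,1) ∧ q = (0,1)) ∨ (p = (0,0) ∧ q = (0,1)) ∨ (p = (0,1) ∧ q = (0,0)) ∨
    (p = (1,0) ∧ q = (1,1)) ∨ (p = (1,1) ∧ q = (1,0)) := by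
  rw [eudist, Real.sqrt_eq_one] at hpq
  simp only [V0, mem_insert, mem_singleton] at hp hq
  rcases hp with rfl | rfl | rfl | rfl <;> rcases hq with rfl | rfl | rfl | rfl <;>
    first
    | (exfalso; norm_num at hpq; done)
    | norm_num

lemma en_words (h : GoodCarpet L A) (n : ℕ) (F : ℝ × ℝ → ℝ) :
    en L A n (grid L n F) = ∑ w : Word A n,
      ((F (PsiW L w (0,0)) - F (PsiW L w (1,0))) ^ 2 +
       (F (PsiW L w (0,1)) - F (PsiW L w (1,1))) ^ 2 +
       (F (PsiW L w (0,0)) - F (PsiW L w (0,1))) ^ 2 +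
       (F (PsiW L w (1,0)) - F (PsiW L w (1,1))) ^ 2) := by
  rw [en, ← sum_words h n (fun c => ce (grid L n F) c.1 c.2)]
  refine sum_congr rfl fun w _ => ?_
  simp only [ce, grid, PsiW_eq h, Nat.cast_add, Nat.cast_one, zero_add, add_comm (1 : ℝ)]

lemma en_le_Dform (h : GoodCarpet L A) (n : ℕ) (F : ℝ × ℝ → ℝ) :
    en L A n (grid L n F) ≤ 8 * Dform L A n F := by
  rw [en_words h, sum_add_distrib, sum_add_distrib, sum_add_distrib]
  have h1 := piece_le h n F (p := (0,0)) (q := (1,0)) (by simp [V0]) (by simp [V0])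
    (by simp [eudist])
  have h2 := piece_le h n F (p := (0,1)) (q := (1,1)) (by simp [V0]) (by simp [V0])
    (by simp [eudist])
  have h3 := piece_le h n F (p := (0,0)) (q := (0,1)) (by simp [V0]) (by simp [V0])
    (by simp [eudist])
  have h4 := piece_le h n F (p := (1,0)) (q := (1,1)) (by simp [V0]) (by simp [V0])
    (by simp [eudist])
  linarith

lemma Dform_le_en (h : GoodCarpet L A) (n : ℕ) (F : ℝ × ℝ → ℝ) :
    Dform L A n F ≤ 8 * en L A n (grid L n F) := by
  have hT : ∀ w : Word A n, ∀ p ∈ V0, ∀ q ∈ V0, eudist p q = 1 →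
      (F (PsiW L w p) - F (PsiW L w q)) ^ 2 ≤
      ((F (PsiW L w (0,0)) - F (PsiW L w (1,0))) ^ 2 +
       (F (PsiW L w (0,1)) - F (PsiW L w (1,1))) ^ 2 +
       (F (PsiW L w (0,0)) - F (PsiW L w (0,1))) ^ 2 +
       (F (PsiW L w (1,0)) - F (PsiW L w (1,1))) ^ 2) := by
    intro w p hp q hq hpq
    have k1 := sq_nonneg (F (PsiW L w (0,0)) - F (PsiW L w (1,0)))
    have k2 := sq_nonneg (F (PsiW L w (0,1)) - F (PsiW L w (1,1)))
    have k3 := sq_nonneg (F (PsiW L w (0,0)) - F (PsiW L w (0,1)))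
    have k4 := sq_nonneg (F (PsiW L w (1,0)) - F (PsiW L w (1,1)))
    rcases V0_dist p q hp hq hpq with ⟨rfl, rfl⟩ | ⟨rfl, rfl⟩ | ⟨rfl, rfl⟩ |
      ⟨rfl, rfl⟩ | ⟨rfl, rfl⟩ | ⟨rfl, rfl⟩ | ⟨rfl, rfl⟩ | ⟨rfl, rfl⟩ <;> nlinarith
  rw [Dform_eq, en_words h]
  have hc : #V0 ≤ 4 := by
    unfold V0
    exact card_le_four
  set S := ((univ : Finset (Word A n)) ×ˢ (V0 ×ˢ V0)).filter (fun t => eudist t.2.1 t.2.2 = 1)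
  have h1 : ∑ z ∈ AP L A n, (F z.1 - F z.2) ^ 2 ≤
      ∑ t ∈ S, (F (PsiW L t.1 t.2.1) - F (PsiW L t.1 t.2.2)) ^ 2 := by
    have hsub : AP L A n ⊆ S.image (fun t => (PsiW L t.1 t.2.1, PsiW L t.1 t.2.2)) := by
      intro z hz
      simp only [AP, mem_filter, mem_product] at hz
      obtain ⟨_, w, p, hp, q, hq, hpq, e1, e2⟩ := hz
      refine mem_image.2 ⟨(w, p, q), ?_, Prod.ext e1.symm e2.symm⟩
      simp [S, hp, hq, hpq]
    refine (sum_le_sum_of_subset_of_nonneg hsub (fun _ _ _ => sq_nonneg _)).trans ?_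
    exact sum_image_le_of_nonneg (g := fun t : Word A n × ((ℝ × ℝ) × (ℝ × ℝ)) =>
      (PsiW L t.1 t.2.1, PsiW L t.1 t.2.2))
      (f := fun z : (ℝ × ℝ) × (ℝ × ℝ) => (F z.1 - F z.2) ^ 2) (fun _ _ => sq_nonneg _)
  refine (mul_le_mul_of_nonneg_left h1 (by norm_num)).trans ?_
  have h2 : ∑ t ∈ S, (F (PsiW L t.1 t.2.1) - F (PsiW L t.1 t.2.2)) ^ 2 ≤
      ∑ t ∈ (univ : Finset (Word A n)) ×ˢ (V0 ×ˢ V0),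
      ((F (PsiW L t.1 (0,0)) - F (PsiW L t.1 (1,0))) ^ 2 +
       (F (PsiW L t.1 (0,1)) - F (PsiW L t.1 (1,1))) ^ 2 +
       (F (PsiW L t.1 (0,0)) - F (PsiW L t.1 (0,1))) ^ 2 +
       (F (PsiW L t.1 (1,0)) - F (PsiW L t.1 (1,1))) ^ 2) := by
    refine (sum_le_sum ?_).trans
      (sum_le_sum_of_subset_of_nonneg (filter_subset _ _) (fun _ _ _ => by positivity))
    intro t ht
    simp only [S, mem_filter, mem_product] at ht
    exact hT t.1 _ ht.1.2.1 _ ht.1.2.2 ht.2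
  rw [sum_product] at h2
  simp only [sum_const, card_product, nsmul_eq_mul] at h2
  rw [← mul_sum] at h2
  have hc2 : (((#V0 * #V0 : ℕ)) : ℝ) ≤ 16 := by
    exact_mod_cast (Nat.mul_le_mul hc hc)
  have h3 := mul_le_mul_of_nonneg_right hc2
    (sum_nonneg (s := (univ : Finset (Word A n))) (f := fun w =>
      ((F (PsiW L w (0,0)) - F (PsiW L w (1,0))) ^ 2 +
       (F (PsiW L w (0,1)) - F (PsiW L w (1,1))) ^ 2 +
       (F (PsiW L w (0,0)) - F (PsiW L w (0,1))) ^ 2 +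
       (F (PsiW L w (1,0)) - F (PsiW L w (1,1))) ^ 2)) (fun _ _ => by positivity))
  linarith

lemma Dform_nonneg (n : ℕ) (F : ℝ × ℝ → ℝ) : 0 ≤ Dform L A n F := by
  rw [Dform_eq]
  exact mul_nonneg (by norm_num) (sum_nonneg fun _ _ => sq_nonneg _)

lemma exists_grid (h : GoodCarpet L A) (n : ℕ) (f : ℕ → ℕ → ℝ) :
    ∃ F : ℝ × ℝ → ℝ, grid L n F = f := by
  have hL : (L : ℝ) ^ n ≠ 0 := by have := lpos h; positivity
  refine ⟨fun z => f ⌊z.1 * (L : ℝ) ^ n⌋₊ ⌊z.2 * (L : ℝ) ^ n⌋₊, ?_⟩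
  funext i j
  simp [grid, div_mul_cancel₀ _ hL]

lemma RR_bounds (h : GoodCarpet L A) (n : ℕ) :
    (8 * EE L A n)⁻¹ ≤ RR L A n ∧ RR L A n ≤ 8 * (EE L A n)⁻¹ := by
  have hL : (L : ℝ) ^ n ≠ 0 := by have := lpos h; positivity
  have hE := EE_pos h n
  set S := {e : ℝ | ∃ f : ℝ × ℝ → ℝ, (∀ x ∈ ({((0 : ℝ), (0 : ℝ))} : Set (ℝ × ℝ)), f x = 1) ∧
    (∀ x ∈ ({((1 : ℝ), (0 : ℝ))} : Set (ℝ × ℝ)), f x = 0) ∧ e = Dform L A n f} with hS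
  have hR : RR L A n = (sInf S)⁻¹ := rfl
  have hb : BddBelow S := ⟨0, by rintro e ⟨f, _, _, rfl⟩; exact Dform_nonneg _ _⟩
  have hmem : ∀ f : ℕ → ℕ → ℝ, f 0 0 = 1 → f (L ^ n) 0 = 0 → sInf S ≤ 8 * en L A n f := by
    intro f f0 f1
    obtain ⟨F, rfl⟩ := exists_grid h n f
    refine (csInf_le hb ⟨F, ?_, ?_, rfl⟩).trans (Dform_le_en h n F)
    · rintro x rfl
      simpa [grid] using f0
    · rintro x rfl
      simpa [grid, div_self hL] using f1
  have hne : S.Nonempty := ⟨_, fun z => 1 - z.1, by simp, by simp, rfl⟩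
  have h1 : sInf S ≤ 8 * EE L A n := by
    have : sInf S / 8 ≤ EE L A n := by
      refine le_csInf (EE_ne h n) ?_
      rintro e ⟨f, f0, f1, rfl⟩
      have := hmem f f0 f1
      linarith
    linarith
  have h2 : EE L A n / 8 ≤ sInf S := by
    refine le_csInf hne ?_
    rintro e ⟨F, F0, F1, rfl⟩
    have k := EE_le (L := L) (A := A) n (grid L n F) (by simpa [grid] using F0)
      (by simpa [grid, div_self hL] using F1)
    have := en_le_Dform h n F
    linarith
  have hpos : 0 < sInf S := lt_of_lt_of_le (by positivity) h2
  rw [hR]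
  constructor
  · exact inv_anti₀ hpos h1
  · have := inv_anti₀ (by positivity) h2
    rwa [inv_div, div_eq_mul_inv] at this

end

/-! ### Quasi-additive sequences -/

lemma quasi_additive (x : ℕ → ℝ) (C : ℝ) (hC : ∀ n m, |x (n + m) - x n - x m| ≤ C) :
    ∃ l : ℝ, ∀ n : ℕ, |x n - n * l| ≤ C := by
  have hC' : ∀ n m, -C ≤ x (n + m) - x n - x m ∧ x (n + m) - x n - x m ≤ C :=
    fun n m => abs_le.1 (hC n m)
  have lo : ∀ n : ℕ, x 0 + n * (x 1 - C) ≤ x n ∧ x n ≤ x 0 + n * (x 1 + C) := by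
    intro n
    induction n with
    | zero => simp
    | succ n ih => have := hC' n 1; push_cast; constructor <;> linarith
  have hu : Subadditive (fun n => x n + C) := by
    intro n m; have := hC' n m; dsimp only; linarith
  have hv : Subadditive (fun n => C - x n) := by
    intro n m; have := hC' n m; dsimp only; linarith
  have aux : ∀ (u : ℕ → ℝ) (a b : ℝ), (∀ n : ℕ, a + n * b ≤ u n) →
      BddBelow (Set.range fun n : ℕ => u n / n) := by
    intro u a b hab
    refine ⟨-|a| - |b|, ?_⟩
    rintro _ ⟨n, rfl⟩
    rcases Nat.eq_zero_or_pos n with rfl | hn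
    · simp; linarith [abs_nonneg a, abs_nonneg b]
    · have hn' : (1 : ℝ) ≤ n := by exact_mod_cast hn
      dsimp only
      rw [le_div_iff₀ (by linarith)]
      nlinarith [hab n, neg_abs_le a, neg_abs_le b, abs_nonneg a]
  have bu := aux (fun n => x n + C) (x 0 + C) (x 1 - C) (fun n => by have := lo n; linarith)
  have bv := aux (fun n => C - x n) (C - x 0) (-(x 1 + C)) (fun n => by have := lo n; linarith)
  have tu := hu.tendsto_lim bu
  have tv := hv.tendsto_lim bv
  have hsum : hu.lim + hv.lim = 0 := by
    refine tendsto_nhds_unique (tu.add tv) ?_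
    have := tendsto_const_div_atTop_nhds_zero_nat (2 * C)
    refine this.congr fun n => ?_
    ring
  refine ⟨hu.lim, fun n => ?_⟩
  rcases Nat.eq_zero_or_pos n with rfl | hn
  · have := hC 0 0
    simpa using this
  · have hn' : (0 : ℝ) < n := by exact_mod_cast hn
    have k1 := hu.lim_le_div bu hn.ne'
    have k2 := hv.lim_le_div bv hn.ne'
    rw [le_div_iff₀ hn'] at k1 k2
    rw [abs_le]
    constructor
    · linarith
    · rw [show hv.lim = -hu.lim by linarith] at k2
      linarith

/-- equation (3.16), planar case: exact geometric growth of the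
resistance sequence `𝓡_n`. -/
theorem resistance_geometric (L : ℕ) (A : Finset (ℕ × ℕ)) (h : GoodCarpet L A) :
    ∃ r c : ℝ, 1 < r ∧ 1 ≤ c ∧
      ∀ n : ℕ, c⁻¹ * r ^ n ≤ RR L A n ∧ RR L A n ≤ c * r ^ n := by
  obtain ⟨K, hK, hEB⟩ := EB_le_EE h
  have hpos := EE_pos h
  have hlog : ∀ n m, |Real.log (EE L A (n + m)) - Real.log (EE L A n) - Real.log (EE L A m)| ≤
      max (Real.log 4) (Real.log (16 * K)) := by
    intro n m
    have hn := hpos n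
    have hm := hpos m
    have hnm := hpos (n + m)
    rw [abs_le]
    constructor
    · have := Real.log_le_log (by positivity) (EE_sub h n m)
      rw [Real.log_mul hn.ne' hm.ne', Real.log_mul (by norm_num) hnm.ne'] at this
      linarith [le_max_left (Real.log 4) (Real.log (16 * K))]
    · have h1 : EE L A (n + m) ≤ 16 * K * (EE L A n * EE L A m) :=
        calc EE L A (n + m) ≤ 16 * EE L A n * EB L A m := EE_super h n m
          _ ≤ 16 * EE L A n * (K * EE L A m) :=
            mul_le_mul_of_nonneg_left (hEB m) (by positivity)
          _ = _ := by ring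
      have := Real.log_le_log hnm h1
      rw [Real.log_mul (by positivity) (by positivity), Real.log_mul hn.ne' hm.ne'] at this
      linarith [le_max_right (Real.log 4) (Real.log (16 * K))]
  obtain ⟨l, hl⟩ := quasi_additive (fun n => Real.log (EE L A n)) _ hlog
  set C := max (Real.log 4) (Real.log (16 * K)) with hCdef
  have hC0 : 0 ≤ C := (abs_nonneg _).trans (hl 0)
  have hκ0 := kappa_pos h
  have hκ1 := kappa_lt h
  set κ := (#A : ℝ) / (L : ℝ) ^ 2 with hκ
  have hlneg : l < 0 := by
    by_contra hcon
    push Not at hcon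
    have hlk : Real.log κ < 0 := Real.log_neg hκ0 hκ1
    have key : ∀ n : ℕ, (n : ℝ) * (-Real.log κ) ≤ Real.log 2 + C := by
      intro n
      have h1 : EE L A n ≤ 2 * κ ^ n := (EE_le_EB h n).trans (EB_decay h n)
      have h2 := Real.log_le_log (hpos n) h1
      rw [Real.log_mul (by norm_num) (by positivity), Real.log_pow] at h2
      have h3 := (abs_le.1 (hl n)).1
      have h4 : 0 ≤ (n : ℝ) * l := by positivity
      linarith
    obtain ⟨n, hn⟩ := exists_nat_gt ((Real.log 2 + C) / (-Real.log κ))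
    rw [div_lt_iff₀ (by linarith)] at hn
    linarith [key n]
  refine ⟨Real.exp (-l), 8 * Real.exp C, by rw [Real.one_lt_exp_iff]; linarith, ?_, fun n => ?_⟩
  · have := Real.one_le_exp hC0
    linarith
  have hb := abs_le.1 (hl n)
  have hEe : EE L A n = Real.exp (Real.log (EE L A n)) := (Real.exp_log (hpos n)).symm
  have hRR := RR_bounds h n
  have hr : Real.exp (-l) ^ n = Real.exp (-(n * l)) := by
    rw [← Real.exp_nat_mul]; ring_nf
  rw [hr]
  constructor
  · refine le_trans ?_ hRR.1
    rw [mul_inv, mul_inv, mul_assoc, ← Real.exp_neg, ← Real.exp_add, hEe, ← Real.exp_neg]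
    refine mul_le_mul_of_nonneg_left (Real.exp_le_exp.2 ?_) (by norm_num)
    linarith
  · refine hRR.2.trans ?_
    rw [mul_assoc, ← Real.exp_add, hEe, ← Real.exp_neg]
    refine mul_le_mul_of_nonneg_left (Real.exp_le_exp.2 ?_) (by norm_num)
    linarith


end Carpet
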